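/- arXiv:0804.3645 — 11 statements merged into one kernel-verified Lean document; each statement's English description precedes it below -/
import Mathlib

section
/- Let γ : ℝ → ℝ be a C^∞ function such that γ(y) = 0 whenever |y| ≥ 1. Let n, s be natural numbers with n ≥ 1, let c > 0 be a real number, and let M ∈ ℝ be such that |γ^(k)(y)| ≤ M for every natural number k ≤ s and every y ∈ ℝ. Then for every x ∈ ℝ, the s-th derivative of the function x ↦ xⁿ·γ(c·x) satisfies |(xⁿ γ(cx))^(s)| ≤ (2n)^s · c^(s−n) · M, where c^(s−n) denotes the power of c with (possibly negative) integer exponent s − n. -/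
/-- bound on the s-th derivative of `x ↦ xⁿ·γ(c·x)` for a smooth
bump-like function `γ` vanishing outside `[-1,1]`. -/
theorem stmt_0 (γ : ℝ → ℝ) (hγ : ContDiff ℝ (⊤ : ℕ∞) γ)
    (hγ0 : ∀ y : ℝ, 1 ≤ |y| → γ y = 0)
    (n s : ℕ) (hn : 1 ≤ n) (c : ℝ) (hc : 0 < c) (M : ℝ)
    (hM : ∀ k : ℕ, k ≤ s → ∀ y : ℝ, |iteratedDeriv k γ y| ≤ M) :
    ∀ x : ℝ,
      |iteratedDeriv s (fun x : ℝ => x ^ n * γ (c * x)) x| ≤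
        (2 * (n : ℝ)) ^ s * c ^ ((s : ℤ) - (n : ℤ)) * M := by
  intro x
  have hM0 : 0 ≤ M := (abs_nonneg _).trans (hM 0 (Nat.zero_le _) 0)
  have hn' : (1 : ℝ) ≤ n := by exact_mod_cast hn
  have hR : 0 ≤ (2 * (n : ℝ)) ^ s * c ^ ((s : ℤ) - (n : ℤ)) * M := by positivity
  rcases lt_or_ge 1 |c * x| with h | h
  · have hev : (fun x : ℝ => x ^ n * γ (c * x)) =ᶠ[nhds x] (fun _ => (0 : ℝ)) := by
      have hcont : Continuous (fun y : ℝ => |c * y|) := by fun_prop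
      filter_upwards [hcont.continuousAt.eventually (lt_mem_nhds h)] with y hy
      rw [hγ0 _ (le_of_lt hy), mul_zero]
    rw [hev.iteratedDeriv_eq]
    simpa [iteratedDeriv_const] using hR
  · have hx : |x| ≤ c⁻¹ := by
      rw [abs_mul, abs_of_pos hc] at h
      rw [← one_div, le_div_iff₀ hc]
      linarith
    have hγs : ContDiff ℝ s γ := hγ.of_le (by exact_mod_cast le_top)
    have h1 : ContDiff ℝ s (fun x : ℝ => x ^ n) := by fun_prop
    have h2 : ContDiff ℝ s (fun x : ℝ => γ (c * x)) := hγs.comp (by fun_prop)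
    rw [iteratedDeriv_fun_mul h1.contDiffAt h2.contDiffAt]
    refine (Finset.abs_sum_le_sum_abs _ _).trans ?_
    have key : ∀ i ∈ Finset.range (s + 1),
        |(s.choose i : ℝ) * iteratedDeriv i (fun x : ℝ => x ^ n) x
          * iteratedDeriv (s - i) (fun x : ℝ => γ (c * x)) x|
        ≤ (n : ℝ) ^ i * 1 ^ (s - i) * (s.choose i : ℝ) * (c ^ ((s : ℤ) - (n : ℤ)) * M) := by
      intro i hi
      have his : i ≤ s := Nat.lt_succ_iff.mp (Finset.mem_range.mp hi)
      have hg : ContDiff ℝ (s - i : ℕ) γ := hγs.of_le (by exact_mod_cast Nat.sub_le s i)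
      rw [iteratedDeriv_comp_const_mul hg]
      simp only [iteratedDeriv_pow]
      rcases lt_or_ge n i with hni | hni
      · rw [Nat.descFactorial_of_lt hni]
        simp
        positivity
      · have hd : ((n.descFactorial i : ℕ) : ℝ) ≤ (n : ℝ) ^ i := by
          exact_mod_cast Nat.descFactorial_le_pow n i
        have hp : |x| ^ (n - i) ≤ (c⁻¹) ^ (n - i) := by gcongr
        have hcz : (c⁻¹) ^ (n - i) * c ^ (s - i) = c ^ ((s : ℤ) - (n : ℤ)) := by
          rw [← zpow_natCast, ← zpow_natCast, inv_zpow', ← zpow_add₀ hc.ne']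
          congr 1
          push_cast [hni, his]
          ring
        have hm := hM (s - i) (Nat.sub_le _ _) (c * x)
        simp only [abs_mul, abs_pow, Nat.abs_cast, abs_of_pos hc]
        rw [← hcz]
        calc _ ≤ (s.choose i : ℝ) * ((n : ℝ) ^ i * (c⁻¹) ^ (n - i)) * (c ^ (s - i) * M) := by
              gcongr
          _ = _ := by ring
    refine (Finset.sum_le_sum key).trans ?_
    rw [← Finset.sum_mul, ← add_pow, mul_assoc]
    gcongr
    linarith
end

section
/- Let γ : ℝ → ℝ be a C^∞ function such that γ(y) = 0 whenever |y| ≥ 1. Let n, s be natural numbers with n ≥ s + 1, let b ∈ ℝ, let c ≥ 1 be a real number, and let M ∈ ℝ be such that |γ^(k)(y)| ≤ M for every natural number k ≤ n and every y ∈ ℝ. Define g : ℝ → ℝ by g(x) = (b/n!)·xⁿ·γ(c·x). Then for every x ∈ ℝ, |g^(s)(x)| ≤ |b| · (2n)^s · c⁻¹ · M. -/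
theorem term_bound (γ : ℝ → ℝ) (hγ0 : ∀ y : ℝ, 1 ≤ |y| → γ y = 0)
    (p q : ℕ) (hpq : q + 1 ≤ p) (c : ℝ) (hc : 1 ≤ c) (M : ℝ)
    (hM : ∀ y : ℝ, |iteratedDeriv q γ y| ≤ M) (x : ℝ) :
    |x ^ p * (c ^ q * iteratedDeriv q γ (c * x))| ≤ c⁻¹ * M := by
  have hc0 : 0 < c := by linarith
  have hM0 : 0 ≤ M := (abs_nonneg _).trans (hM 0)
  by_cases h : 1 < |c * x|
  · have he : γ =ᶠ[nhds (c * x)] fun _ => (0 : ℝ) := by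
      have : ∀ᶠ y in nhds (c * x), 1 < |y| :=
        continuous_abs.continuousAt.eventually (lt_mem_nhds h)
      filter_upwards [this] with y hy using hγ0 y hy.le
    have hz : iteratedDeriv q γ (c * x) = 0 := by
      rw [he.iteratedDeriv_eq q]; simp
    rw [hz]; simp; positivity
  · have h1 : c * |x| ≤ 1 := by
      have := not_lt.mp h
      rwa [abs_mul, abs_of_pos hc0] at this
    have hx1 : |x| ≤ 1 := by nlinarith [abs_nonneg x]
    rw [abs_mul, abs_mul, abs_pow, abs_pow, abs_of_pos hc0, ← mul_assoc]
    apply mul_le_mul _ (hM _) (abs_nonneg _) (by positivity)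
    rw [← one_div, le_div_iff₀ hc0]
    calc |x| ^ p * c ^ q * c ≤ |x| ^ (q + 1) * c ^ q * c := by
          have := pow_le_pow_of_le_one (abs_nonneg x) hx1 hpq
          gcongr
      _ = (c * |x|) ^ (q + 1) := by ring
      _ ≤ 1 := pow_le_one₀ (by positivity) h1


/-- bound on the s-th derivative of `g(x) = (b/n!)·xⁿ·γ(c·x)`
when `c ≥ 1` and `n ≥ s + 1`. -/
theorem stmt_1 (γ : ℝ → ℝ) (hγ : ContDiff ℝ (⊤ : ℕ∞) γ)
    (hγ0 : ∀ y : ℝ, 1 ≤ |y| → γ y = 0)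
    (n s : ℕ) (hns : s + 1 ≤ n) (b : ℝ) (c : ℝ) (hc : 1 ≤ c) (M : ℝ)
    (hM : ∀ k : ℕ, k ≤ n → ∀ y : ℝ, |iteratedDeriv k γ y| ≤ M)
    (g : ℝ → ℝ) (hg : g = fun x : ℝ => (b / (n.factorial : ℝ)) * x ^ n * γ (c * x)) :
    ∀ x : ℝ, |iteratedDeriv s g x| ≤ |b| * (2 * (n : ℝ)) ^ s * c⁻¹ * M := by
  intro x
  have hc0 : 0 < c := by linarith
  have hM0 : 0 ≤ M := (abs_nonneg _).trans (hM 0 (Nat.zero_le _) 0)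
  have hγs : ∀ k : ℕ, ContDiff ℝ k γ := fun k => hγ.of_le (by exact_mod_cast le_top)
  have hg' : g = fun x : ℝ => (b / (n.factorial : ℝ)) * (x ^ n * γ (c * x)) := by
    rw [hg]; funext y; ring
  have hn1 : (1 : ℝ) ≤ n := by exact_mod_cast (by omega : 1 ≤ n)
  have hcd : ContDiffAt ℝ s (fun x => γ (c * x)) x :=
    ((hγs s).comp (contDiff_const.mul contDiff_id)).contDiffAt
  have hpd : ContDiffAt ℝ s (fun x : ℝ => x ^ n) x := by fun_prop
  rw [hg', iteratedDeriv_const_mul_field, iteratedDeriv_fun_mul hpd hcd, abs_mul]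
  have hb : |b / (n.factorial : ℝ)| ≤ |b| := by
    rw [abs_div, Nat.abs_cast]
    exact div_le_self (abs_nonneg _) (by exact_mod_cast Nat.one_le_iff_ne_zero.mpr n.factorial_ne_zero)
  have hsum : |∑ i ∈ Finset.range (s + 1), (s.choose i : ℝ) * iteratedDeriv i (fun x : ℝ => x ^ n) x
      * iteratedDeriv (s - i) (fun x => γ (c * x)) x| ≤ (2 * (n : ℝ)) ^ s * (c⁻¹ * M) := by
    calc _ ≤ ∑ i ∈ Finset.range (s + 1), (s.choose i : ℝ) * ((n : ℝ) ^ s * (c⁻¹ * M)) := by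
          refine (Finset.abs_sum_le_sum_abs _ _).trans (Finset.sum_le_sum fun i hi => ?_)
          have his : i ≤ s := by have := Finset.mem_range.mp hi; omega
          have ht := term_bound γ hγ0 (n - i) (s - i) (by omega) c hc M
            (hM _ (by omega)) x
          rw [iteratedDeriv_pow, iteratedDeriv_comp_const_mul (hγs _)]
          have hd : (n.descFactorial i : ℝ) ≤ (n : ℝ) ^ s := by
            calc (n.descFactorial i : ℝ) ≤ (n : ℝ) ^ i := by
                  exact_mod_cast Nat.descFactorial_le_pow n i
              _ ≤ _ := pow_le_pow_right₀ hn1 his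
          rw [mul_assoc, abs_mul, Nat.abs_cast, mul_assoc, abs_mul, Nat.abs_cast]
          gcongr
      _ = _ := by
          rw [← Finset.sum_mul, mul_pow, mul_assoc]
          congr 1
          exact_mod_cast Nat.sum_range_choose s
  calc _ ≤ |b| * ((2 * (n : ℝ)) ^ s * (c⁻¹ * M)) :=
        mul_le_mul hb hsum (abs_nonneg _) (abs_nonneg _)
    _ = _ := by ring
end

section
/- Let γ : ℝ → ℝ be a C^∞ function such that γ(y) = 0 whenever |y| ≥ 1. Let n, s be natural numbers with n ≥ s + 1, let b ∈ ℝ, let d > 0 be a real number, and let M ∈ ℝ be such that |γ^(k)(y)| ≤ M for every natural number k ≤ n and every y ∈ ℝ. Set c = n · 2^(2n) · (|b|/d) · M + 3 and define g : ℝ → ℝ by g(x) = (b/n!)·xⁿ·γ(c·x). Then for every x ∈ ℝ, |g^(s)(x)| ≤ n^(s−1) · d / 2ⁿ, where n^(s−1) denotes the power of the real number n with the (possibly negative) integer exponent s − 1. -/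
/-- with the choice `c = n·2^(2n)·(|b|/d)·M + 3`, the s-th derivative
of `g(x) = (b/n!)·xⁿ·γ(c·x)` is bounded by `n^(s−1)·d / 2ⁿ`. -/
theorem stmt_2 (γ : ℝ → ℝ) (hγ : ContDiff ℝ (⊤ : ℕ∞) γ)
    (hγ0 : ∀ y : ℝ, 1 ≤ |y| → γ y = 0)
    (n s : ℕ) (hns : s + 1 ≤ n) (b : ℝ) (d : ℝ) (hd : 0 < d) (M : ℝ)
    (hM : ∀ k : ℕ, k ≤ n → ∀ y : ℝ, |iteratedDeriv k γ y| ≤ M)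
    (c : ℝ) (hc : c = (n : ℝ) * 2 ^ (2 * n) * (|b| / d) * M + 3)
    (g : ℝ → ℝ) (hg : g = fun x : ℝ => (b / (n.factorial : ℝ)) * x ^ n * γ (c * x)) :
    ∀ x : ℝ, |iteratedDeriv s g x| ≤ (n : ℝ) ^ ((s : ℤ) - 1) * d / 2 ^ n := by
  intro x
  have hM0 : 0 ≤ M := (abs_nonneg _).trans (hM 0 (Nat.zero_le _) 0)
  have hn1 : (1 : ℝ) ≤ n := by exact_mod_cast (by omega : 1 ≤ n)
  have hn0 : (0 : ℝ) < n := by linarith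
  have hK : 0 ≤ (n : ℝ) * 2 ^ (2 * n) * (|b| / d) * M := by positivity
  have hc3 : 3 ≤ c := by linarith
  have hc0 : 0 < c := by linarith
  have hf0 : (0 : ℝ) < n.factorial := by exact_mod_cast n.factorial_pos
  have hzero : ∀ k : ℕ, ∀ y : ℝ, 1 < |y| → iteratedDeriv k γ y = 0 := by
    intro k y hy
    have h1 : γ =ᶠ[nhds y] fun _ => (0 : ℝ) := by
      have h2 : ∀ᶠ z in nhds y, 1 < |z| :=
        continuous_abs.continuousAt.eventually (lt_mem_nhds hy)
      filter_upwards [h2] with z hz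
      exact hγ0 z hz.le
    rw [h1.iteratedDeriv_eq k, iteratedDeriv_const]
    simp
  have hterm : ∀ i ≤ s, |x| ^ (n - i) * (c ^ (s - i) * |iteratedDeriv (s - i) γ (c * x)|) ≤ M / c := by
    intro i hi
    rcases lt_or_ge 1 |c * x| with h | h
    · rw [hzero _ _ h]
      simp only [abs_zero, mul_zero]
      positivity
    · rw [le_div_iff₀ hc0]
      have h1 : c ^ (s - i + 1) ≤ c ^ (n - i) :=
        pow_le_pow_right₀ (by linarith) (by omega)
      have h2 : |x| ^ (n - i) * c ^ (s - i + 1) ≤ 1 := by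
        calc |x| ^ (n - i) * c ^ (s - i + 1) ≤ |x| ^ (n - i) * c ^ (n - i) := by gcongr
          _ = |c * x| ^ (n - i) := by rw [← mul_pow, abs_mul, abs_of_pos hc0, mul_comm]
          _ ≤ 1 := pow_le_one₀ (abs_nonneg _) h
      calc _ = (|x| ^ (n - i) * c ^ (s - i + 1)) * |iteratedDeriv (s - i) γ (c * x)| := by ring
        _ ≤ 1 * M := mul_le_mul h2 (hM _ (by omega) _) (abs_nonneg _) zero_le_one
        _ = M := one_mul M
  have hcomp : ∀ k : ℕ, iteratedDeriv k (fun x => γ (c * x)) x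
      = c ^ k * iteratedDeriv k γ (c * x) := by
    intro k
    rw [iteratedDeriv_comp_const_mul (hγ.of_le (by exact_mod_cast le_top))]
  have hder : iteratedDeriv s g x = (b / n.factorial) * ∑ i ∈ Finset.range (s + 1),
      (s.choose i : ℝ) * (n.descFactorial i * x ^ (n - i)) *
        (c ^ (s - i) * iteratedDeriv (s - i) γ (c * x)) := by
    have e : g = fun x => (b / (n.factorial : ℝ)) * (((fun x => x ^ n) * (fun x => γ (c * x)) : ℝ → ℝ) x) := by
      rw [hg]; funext z; simp only [Pi.mul_apply]; ring
    rw [e, iteratedDeriv_const_mul_field, iteratedDeriv_mul]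
    · simp only [iteratedDeriv_pow, hcomp]
    · exact (contDiff_id.pow n).contDiffAt
    · have h1 : ContDiff ℝ s γ := hγ.of_le (by exact_mod_cast le_top)
      exact (h1.comp (contDiff_const.mul contDiff_id)).contDiffAt
  have hsum : |∑ i ∈ Finset.range (s + 1),
      (s.choose i : ℝ) * (n.descFactorial i * x ^ (n - i)) *
        (c ^ (s - i) * iteratedDeriv (s - i) γ (c * x))| ≤ 2 ^ s * (n.factorial * (M / c)) := by
    refine (Finset.abs_sum_le_sum_abs _ _).trans ?_
    have e : (2 : ℝ) ^ s = ∑ i ∈ Finset.range (s + 1), (s.choose i : ℝ) := by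
      exact_mod_cast (Nat.sum_range_choose s).symm
    rw [e, Finset.sum_mul]
    refine Finset.sum_le_sum fun i hi => ?_
    have hi' : i ≤ s := by simpa [Nat.lt_succ_iff] using hi
    have hdf : (n.descFactorial i : ℝ) ≤ n.factorial := by
      have := Nat.factorial_mul_descFactorial (show i ≤ n by omega)
      have h2 := Nat.factorial_pos (n - i)
      exact_mod_cast (by nlinarith : n.descFactorial i ≤ n.factorial)
    simp only [abs_mul, abs_pow, Nat.abs_cast, abs_of_pos hc0]
    rw [mul_assoc, mul_assoc]
    refine mul_le_mul_of_nonneg_left ?_ (Nat.cast_nonneg _)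
    exact mul_le_mul hdf (hterm i hi') (by positivity) hf0.le
  have hbM : |b| * (M / c) ≤ d / (n * 2 ^ (2 * n)) := by
    rw [← mul_div_assoc, div_le_div_iff₀ hc0 (by positivity)]
    have : d * ((n : ℝ) * 2 ^ (2 * n) * (|b| / d) * M) = |b| * M * (n * 2 ^ (2 * n)) := by
      field_simp
    rw [hc, mul_add, this]
    linarith
  rw [hder, abs_mul, abs_div, Nat.abs_cast]
  calc _ ≤ |b| / n.factorial * (2 ^ s * (n.factorial * (M / c))) := by gcongr
    _ = 2 ^ s * (|b| * (M / c)) := by field_simp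
    _ ≤ 2 ^ n * (d / (n * 2 ^ (2 * n))) := by
        gcongr
        · norm_num
        · omega
    _ = 1 * (n : ℝ)⁻¹ * d / 2 ^ n := by
        rw [two_mul, pow_add]; field_simp
    _ ≤ (n : ℝ) ^ s * (n : ℝ)⁻¹ * d / 2 ^ n := by
        gcongr
        exact one_le_pow₀ hn1
    _ = _ := by rw [zpow_sub_one₀ hn0.ne', zpow_natCast]
end

section
/- For every sequence f : ℕ → ℝ with f(1) > 0 there exists a C^∞ function g : ℝ → ℝ such that: (i) g^(n)(0) = f(n) for every n ∈ ℕ; (ii) |g'(x) − f(1)| ≤ f(1)/2, and in particular g'(x) ≥ f(1)/2 > 0, for every x ∈ ℝ; (iii) g(x) = f(0) + f(1)·x whenever |x| ≥ 1/3; in particular g is surjective, and hence g is an orientation-preserving C^∞ diffeomorphism of ℝ. -/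
lemma borel_bound (φ : ℝ → ℝ) (h : ContDiff ℝ (⊤ : ℕ∞) φ) (hc : HasCompactSupport φ) :
    ∃ B : ℕ → ℝ, ∀ k, 0 ≤ B k ∧ ∀ x, |iteratedDeriv k φ x| ≤ B k := by
  have : ∀ k : ℕ, ∃ C : ℝ, 0 ≤ C ∧ ∀ x, |iteratedDeriv k φ x| ≤ C := by
    intro k
    obtain ⟨C, hC⟩ := (h.continuous_iteratedFDeriv (m := k)
      (by exact_mod_cast le_top)).bounded_above_of_compact_support (hc.iteratedFDeriv (𝕜 := ℝ) k)
    refine ⟨C, (norm_nonneg _).trans (hC 0), fun x => ?_⟩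
    have := hC x
    rwa [norm_iteratedFDeriv_eq_norm_iteratedDeriv] at this
  choose B hB using this
  exact ⟨B, hB⟩

lemma borel_term (n : ℕ) (a η : ℝ) (hη : 0 < η) :
    ∃ u : ℝ → ℝ, ContDiff ℝ (⊤ : ℕ∞) u ∧ (∀ x, 1 / 3 ≤ |x| → u x = 0) ∧
      (∀ k, iteratedDeriv k u 0 = if k = n then a else 0) ∧
      (∀ k, k < n → ∀ x, |iteratedDeriv k u x| ≤ η) ∧
      ∃ B : ℕ → ℝ, ∀ k, 0 ≤ B k ∧ ∀ x, |iteratedDeriv k u x| ≤ B k := by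
  let χ : ContDiffBump (0 : ℝ) := ⟨1 / 6, 1 / 3, by norm_num, by norm_num⟩
  let φ : ℝ → ℝ := fun x => (a / n.factorial * x ^ n) * χ x
  have hφ : ContDiff ℝ (⊤ : ℕ∞) φ :=
    (contDiff_const.mul (contDiff_id.pow n)).mul χ.contDiff
  have hφc : HasCompactSupport φ := χ.hasCompactSupport.mul_left
  have hφ0 : ∀ x, 1 / 3 ≤ |x| → φ x = 0 := by
    intro x hx
    have : χ x = 0 := χ.zero_of_le_dist (by simpa [χ, Real.dist_eq] using hx)
    simp [φ, this]
  have hφj : ∀ k, iteratedDeriv k φ 0 = if k = n then a else 0 := by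
    intro k
    have h1 : φ =ᶠ[nhds 0] fun x => a / n.factorial * x ^ n := by
      filter_upwards [χ.eventuallyEq_one] with x hx
      simp [φ, hx]
    rw [h1.iteratedDeriv_eq, iteratedDeriv_const_mul_field, iteratedDeriv_fun_pow_zero]
    have : (n.factorial : ℝ) ≠ 0 := by positivity
    split_ifs with h
    · subst h
      field_simp
    · simp
  obtain ⟨B, hB⟩ := borel_bound φ hφ hφc
  set M := ∑ k ∈ Finset.range n, B k with hM
  have hM0 : 0 ≤ M := Finset.sum_nonneg fun k _ => (hB k).1
  set ε := min 1 (η / (M + 1)) with hε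
  have hε0 : 0 < ε := lt_min one_pos (by positivity)
  have hε1 : ε ≤ 1 := min_le_left _ _
  have hε2 : ε * M ≤ η := by
    calc ε * M ≤ η / (M + 1) * (M + 1) := by
          gcongr
          · exact min_le_right _ _
          · linarith
      _ = η := by field_simp
  have hd : ∀ k x, iteratedDeriv k (fun x => ε ^ n * φ (ε⁻¹ * x)) x
      = ε ^ n * (ε⁻¹ ^ k * iteratedDeriv k φ (ε⁻¹ * x)) := by
    intro k x
    rw [iteratedDeriv_const_mul_field, iteratedDeriv_comp_const_mul
      (hφ.of_le (by exact_mod_cast le_top))]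
  have hb : ∀ k x, |iteratedDeriv k (fun x => ε ^ n * φ (ε⁻¹ * x)) x|
      ≤ ε ^ n * (ε⁻¹ ^ k * B k) := by
    intro k x
    rw [hd, abs_mul, abs_mul, abs_of_pos (by positivity : 0 < ε ^ n),
      abs_of_pos (by positivity : 0 < ε⁻¹ ^ k)]
    gcongr
    exact (hB k).2 _
  refine ⟨fun x => ε ^ n * φ (ε⁻¹ * x), ?_, ?_, ?_, ?_, fun k => ε ^ n * (ε⁻¹ ^ k * B k), ?_⟩
  · exact contDiff_const.mul (hφ.comp (contDiff_const.mul contDiff_id))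
  · intro x hx
    have : 1 / 3 ≤ |ε⁻¹ * x| := by
      rw [abs_mul, abs_of_pos (by positivity : 0 < ε⁻¹)]
      have : 1 ≤ ε⁻¹ := (one_le_inv₀ hε0).2 hε1
      nlinarith [abs_nonneg x]
    simp [hφ0 _ this]
  · intro k
    rw [hd, mul_zero, hφj]
    split_ifs with h
    · subst h
      rw [← mul_assoc, ← mul_pow, mul_inv_cancel₀ hε0.ne', one_pow, one_mul]
    · simp
  · intro k hk x
    refine (hb k x).trans ?_
    have h1 : ε ^ n * ε⁻¹ ^ k ≤ ε := by
      obtain ⟨j, rfl⟩ : ∃ j, n = k + (j + 1) := ⟨n - k - 1, by omega⟩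
      have : ε ^ (k + (j + 1)) * ε⁻¹ ^ k = ε ^ (j + 1) := by
        rw [pow_add, inv_pow]
        field_simp
      rw [this]
      exact pow_le_of_le_one hε0.le hε1 (by omega)
    have h2 : B k ≤ M :=
      Finset.single_le_sum (f := B) (fun i _ => (hB i).1) (Finset.mem_range.2 hk)
    calc ε ^ n * (ε⁻¹ ^ k * B k) = (ε ^ n * ε⁻¹ ^ k) * B k := by ring
      _ ≤ ε * M := by
        have := (hB k).1
        gcongr
      _ ≤ η := hε2
  · intro k
    have := (hB k).1
    exact ⟨by positivity, hb k⟩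


/-- Borel-type section at a single point: for every sequence `f`
with `f 1 > 0` there is a smooth `g` with prescribed jet at `0`, derivative
close to `f 1` (hence positive), affine outside `[-1/3, 1/3]`, surjective,
hence an orientation-preserving C^∞ diffeomorphism of ℝ. -/
theorem stmt_3 (f : ℕ → ℝ) (hf : 0 < f 1) :
    ∃ g : ℝ → ℝ, ContDiff ℝ (⊤ : ℕ∞) g ∧
      (∀ n : ℕ, iteratedDeriv n g 0 = f n) ∧
      (∀ x : ℝ, |deriv g x - f 1| ≤ f 1 / 2) ∧
      (∀ x : ℝ, f 1 / 2 ≤ deriv g x) ∧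
      (∀ x : ℝ, 0 < deriv g x) ∧
      (∀ x : ℝ, 1 / 3 ≤ |x| → g x = f 0 + f 1 * x) ∧
      Function.Surjective g := by
  have hη : ∀ i : ℕ, 0 < f 1 / 4 * (1 / 2 : ℝ) ^ i := fun i => by positivity
  choose u hu hu0 huj hub B hB using fun i : ℕ => borel_term (i + 2) (f (i + 2)) _ (hη i)
  have hη1 : Summable fun i : ℕ => f 1 / 4 * (1 / 2 : ℝ) ^ i := summable_geometric_two.mul_left _
  let v : ℕ → ℕ → ℝ := fun k i => if k < i + 2 then f 1 / 4 * (1 / 2 : ℝ) ^ i else B i k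
  have hv : ∀ k : ℕ, (k : ℕ∞) ≤ ⊤ → Summable (v k) := by
    intro k _
    refine hη1.of_norm_bounded_eventually_nat ?_
    filter_upwards [Filter.eventually_ge_atTop k] with i hi
    have : k < i + 2 := by omega
    simp only [v, if_pos this]
    rw [Real.norm_of_nonneg (hη i).le]
  have hvb : ∀ (k : ℕ) (i : ℕ) (x : ℝ), (k : ℕ∞) ≤ ⊤ → ‖iteratedFDeriv ℝ k (u i) x‖ ≤ v k i := by
    intro k i x _
    rw [norm_iteratedFDeriv_eq_norm_iteratedDeriv, Real.norm_eq_abs]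
    simp only [v]
    split_ifs with h
    · exact hub i k h x
    · exact (hB i k).2 x
  let S : ℝ → ℝ := fun x => ∑' i, u i x
  have hS : ContDiff ℝ (⊤ : ℕ∞) S := contDiff_tsum hu hv hvb
  have hSd : ∀ k x, iteratedDeriv k S x = ∑' i, iteratedDeriv k (u i) x := by
    intro k x
    have hs : Summable fun i => iteratedFDeriv ℝ k (u i) x :=
      .of_norm_bounded (hv k le_top) fun i => hvb k i x le_top
    simp only [iteratedDeriv_eq_iteratedFDeriv]
    rw [show iteratedFDeriv ℝ k S x = ∑' i, iteratedFDeriv ℝ k (u i) x from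
      iteratedFDeriv_tsum_apply hu hv hvb le_top x]
    exact ((ContinuousMultilinearMap.apply ℝ (fun _ : Fin k => ℝ) ℝ (fun _ => 1)).map_tsum hs)
  have hS0 : ∀ x, 1 / 3 ≤ |x| → S x = 0 := by
    intro x hx
    simp [S, hu0 _ x hx]
  have hSb : ∀ x, |deriv S x| ≤ f 1 / 2 := by
    intro x
    rw [← iteratedDeriv_one, hSd]
    have h1 : HasSum (fun i : ℕ => f 1 / 4 * (1 / 2 : ℝ) ^ i) (f 1 / 2) := by
      have := hasSum_geometric_two.mul_left (f 1 / 4)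
      rwa [show f 1 / 4 * 2 = f 1 / 2 by ring] at this
    rw [← Real.norm_eq_abs]
    refine tsum_of_norm_bounded h1 fun i => ?_
    rw [Real.norm_eq_abs]
    exact hub i 1 (by omega) x
  let g : ℝ → ℝ := fun x => (f 0 + f 1 * x) + S x
  have hA : ContDiff ℝ (⊤ : ℕ∞) fun x : ℝ => f 0 + f 1 * x :=
    contDiff_const.add (contDiff_const.mul contDiff_id)
  have hg : ContDiff ℝ (⊤ : ℕ∞) g := hA.add hS
  have hAd : deriv (fun x : ℝ => f 0 + f 1 * x) = fun _ => f 1 := by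
    ext x
    have := ((hasDerivAt_id x).const_mul (f 1)).const_add (f 0)
    simp
  have hgd : ∀ x, deriv g x = f 1 + deriv S x := by
    intro x
    have := deriv_fun_add (hA.differentiable (by simp) x) (hS.differentiable (by simp) x)
    rw [hAd] at this
    exact this
  have hga : ∀ x : ℝ, 1 / 3 ≤ |x| → g x = f 0 + f 1 * x := fun x hx => by simp [g, hS0 x hx]
  have hlo : ∀ x, f 1 / 2 ≤ deriv g x := fun x => by
    have := abs_le.1 (hSb x)
    rw [hgd]
    linarith
  refine ⟨g, hg, ?_, fun x => ?_, hlo, fun x => by linarith [hlo x], hga, ?_⟩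
  · intro n
    have h1 : iteratedDeriv n g 0
        = iteratedDeriv n (fun x : ℝ => f 0 + f 1 * x) 0 + iteratedDeriv n S 0 :=
      iteratedDeriv_fun_add (hA.contDiffAt.of_le (by exact_mod_cast le_top))
        (hS.contDiffAt.of_le (by exact_mod_cast le_top))
    rw [h1, hSd]
    simp only [huj]
    match n with
    | 0 => simp
    | 1 => simp [hAd]
    | m + 2 =>
      rw [iteratedDeriv_succ', hAd, iteratedDeriv_const, tsum_eq_single m]
      · simp
      · intro b hb
        rw [if_neg (by omega)]
  · rw [hgd]
    simpa using hSb x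
  · refine hg.continuous.surjective ?_ ?_
    · refine (Filter.tendsto_atTop_add_const_left _ (f 0)
        (Filter.tendsto_id.const_mul_atTop hf)).congr' ?_
      filter_upwards [Filter.eventually_ge_atTop (1 / 3 : ℝ)] with x hx
      exact (hga x (hx.trans (le_abs_self x))).symm
    · refine (Filter.tendsto_atBot_add_const_left _ (f 0)
        (Filter.tendsto_id.const_mul_atBot hf)).congr' ?_
      filter_upwards [Filter.eventually_le_atBot (-(1 / 3) : ℝ)] with x hx
      exact (hga x (by linarith [neg_le_abs x])).symm
end

section
/- The set of all sequences f : ℕ → ℝ for which there exists a surjective C^∞ function g : ℝ → ℝ with g'(x) > 0 for all x ∈ ℝ and g^(n)(0) = f(n) for every n ∈ ℕ is exactly the set {f : ℕ → ℝ | f(1) > 0}. In other words, the jet map ∂^ω_0 : g ↦ (g^(n)(0))_{n∈ℕ} maps the orientation-preserving C^∞ diffeomorphisms of ℝ onto {f : ℕ → ℝ | f(1) > 0}. -/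
lemma term_exists (n : ℕ) (a ε : ℝ) (hε : 0 < ε) : ∃ F : ℝ → ℝ, ContDiff ℝ (⊤ : ℕ∞) F ∧
    (∀ k : ℕ, ∃ C, ∀ x, ‖iteratedDeriv k F x‖ ≤ C) ∧
    (∀ k < n, ∀ x, ‖iteratedDeriv k F x‖ ≤ ε) ∧
    (∀ k, iteratedDeriv k F 0 = if k = n then a else 0) := by
  let χ : ContDiffBump (0 : ℝ) := ⟨1, 2, one_pos, one_lt_two⟩
  let φ : ℝ → ℝ := fun x => x ^ n * χ x
  have hφ : ContDiff ℝ (⊤ : ℕ∞) φ := (contDiff_id.pow n).mul χ.contDiff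
  have hφs : HasCompactSupport φ := χ.hasCompactSupport.mul_left
  have hb : ∀ k : ℕ, ∃ C, ∀ x, ‖iteratedDeriv k φ x‖ ≤ C := by
    intro k
    have h1 : HasCompactSupport (iteratedFDeriv ℝ k φ) := hφs.iteratedFDeriv k
    obtain ⟨C, hC⟩ := (hφ.continuous_iteratedFDeriv (m := k) (by exact_mod_cast le_top)).bounded_above_of_compact_support h1
    exact ⟨C, fun x => by rw [← norm_iteratedFDeriv_eq_norm_iteratedDeriv]; exact hC x⟩
  choose M hM using hb
  have hM0 : ∀ k, 0 ≤ M k := fun k => (norm_nonneg _).trans (hM k 0)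
  let S := ∑ k ∈ Finset.range n, M k
  have hS0 : 0 ≤ S := Finset.sum_nonneg fun k _ => hM0 k
  have hS : ∀ k < n, M k ≤ S := fun k hk =>
    Finset.single_le_sum (f := M) (fun k _ => hM0 k) (Finset.mem_range.2 hk)
  let t : ℝ := 1 + |a| * S / ε
  have ht1 : 1 ≤ t := by
    have : 0 ≤ |a| * S / ε := by positivity
    simp only [t]; linarith
  have ht0 : 0 < t := by linarith
  have ht : |a| * S ≤ ε * t := by
    have : ε * t = ε + |a| * S := by simp only [t]; field_simp
    linarith
  let c : ℝ := a / n.factorial / t ^ n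
  have hfor : ∀ k x, iteratedDeriv k (fun x => c * φ (t * x)) x
      = c * (t ^ k * iteratedDeriv k φ (t * x)) := by
    intro k x
    rw [iteratedDeriv_const_mul_field,
      iteratedDeriv_comp_const_mul (hφ.of_le (by exact_mod_cast le_top))]
  refine ⟨fun x => c * φ (t * x), by fun_prop, ?_, ?_, ?_⟩
  · intro k
    refine ⟨‖c‖ * (‖t ^ k‖ * M k), fun x => ?_⟩
    rw [hfor, norm_mul, norm_mul]
    gcongr
    exact hM _ _
  · intro k hk x
    rw [hfor, norm_mul, norm_mul]
    have h1 : ‖c‖ ≤ |a| / t ^ n := by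
      simp only [c, norm_div, Real.norm_eq_abs, abs_pow, abs_of_pos ht0]
      gcongr
      apply div_le_self (abs_nonneg _)
      rw [Nat.abs_cast]
      exact_mod_cast n.factorial_pos
    have h2 : ‖t ^ k‖ * t ≤ t ^ n := by
      rw [norm_pow, Real.norm_eq_abs, abs_of_pos ht0, ← pow_succ]
      exact pow_le_pow_right₀ ht1 hk
    have h3 : ‖iteratedDeriv k φ (t * x)‖ ≤ S := (hM _ _).trans (hS k hk)
    have h4 : ‖t ^ k‖ ≤ t ^ n / t := by rwa [le_div_iff₀ ht0]
    calc _ ≤ |a| / t ^ n * (t ^ n / t * S) := by gcongr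
      _ = |a| * S / t := by field_simp
      _ ≤ ε := by rwa [div_le_iff₀ ht0]
  · intro k
    rw [hfor, mul_zero]
    have he : φ =ᶠ[nhds 0] (fun x => x ^ n) := by
      filter_upwards [χ.eventuallyEq_one] with x hx
      simp [φ, hx]
    rw [he.iteratedDeriv_eq, iteratedDeriv_pow]
    split_ifs with h
    · subst h
      simp only [Nat.descFactorial_self, tsub_self, pow_zero, c]
      field_simp
    · rcases lt_or_gt_of_ne h with h | h
      · rw [zero_pow (by omega)]; simp
      · rw [Nat.descFactorial_eq_zero_iff_lt.2 h]; simp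

lemma borel_exists (f : ℕ → ℝ) (a : ℝ) (ha : 0 < a) : ∃ h : ℝ → ℝ, ContDiff ℝ (⊤ : ℕ∞) h ∧
    (∀ x, ‖deriv h x‖ ≤ a) ∧
    (∀ k, iteratedDeriv k h 0 = if 2 ≤ k then f k else 0) := by
  have hε : ∀ n : ℕ, 0 < a / 2 / 2 ^ n := fun n => by positivity
  choose F hF hC hFε hF0 using fun n : ℕ => term_exists (n + 2) (f (n + 2)) _ (hε n)
  choose C hC using hC
  let v : ℕ → ℕ → ℝ := fun k n => if k < n + 2 then a / 2 / 2 ^ n else C n k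
  have hgeo : HasSum (fun n : ℕ => a / 2 / 2 ^ n) a := hasSum_geometric_two' a
  have hv : ∀ k, Summable (v k) := by
    intro k
    refine (summable_nat_add_iff k).1 ?_
    refine ((summable_nat_add_iff k).2 hgeo.summable).congr fun n => ?_
    simp only [v]
    rw [if_pos (by omega)]
  have hbd : ∀ k n x, ‖iteratedDeriv k (F n) x‖ ≤ v k n := by
    intro k n x
    simp only [v]
    split_ifs with h
    · exact hFε n k h x
    · exact hC n k x
  have hbd' : ∀ (k n : ℕ) (x : ℝ), (k : ℕ∞) ≤ ⊤ → ‖iteratedFDeriv ℝ k (F n) x‖ ≤ v k n := by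
    intro k n x _
    rw [norm_iteratedFDeriv_eq_norm_iteratedDeriv]
    exact hbd k n x
  have hsm : ContDiff ℝ (⊤ : ℕ∞) (fun x => ∑' n, F n x) :=
    contDiff_tsum hF (fun k _ => hv k) hbd'
  have hder : ∀ k x, iteratedDeriv k (fun x => ∑' n, F n x) x = ∑' n, iteratedDeriv k (F n) x := by
    intro k x
    simp only [iteratedDeriv]
    rw [iteratedFDeriv_tsum_apply hF (fun k _ => hv k) hbd' le_top]
    rw [ContinuousMultilinearMap.tsum_eval]
    exact Summable.of_norm_bounded (hv k) (fun n => hbd' k n x le_top)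
  refine ⟨_, hsm, ?_, ?_⟩
  · intro x
    rw [← iteratedDeriv_one, hder]
    exact tsum_of_norm_bounded hgeo fun n => hFε n 1 (by omega) x
  · intro k
    rw [hder]
    simp only [hF0]
    split_ifs with h
    · obtain ⟨m, rfl⟩ := Nat.exists_eq_add_of_le' h
      rw [tsum_eq_single m]
      · simp
      · intro b hb
        rw [if_neg (by omega)]
    · convert tsum_zero with n
      rw [if_neg (by omega)]

/-- the jet map `g ↦ (g^(n)(0))ₙ` maps the orientation-preserving
C^∞ diffeomorphisms of ℝ onto `{f : ℕ → ℝ | f 1 > 0}`. -/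
theorem stmt_4 :
    {f : ℕ → ℝ | ∃ g : ℝ → ℝ, ContDiff ℝ (⊤ : ℕ∞) g ∧ Function.Surjective g ∧
        (∀ x : ℝ, 0 < deriv g x) ∧ ∀ n : ℕ, iteratedDeriv n g 0 = f n} =
      {f : ℕ → ℝ | 0 < f 1} := by
  ext f
  simp only [Set.mem_setOf_eq]
  constructor
  · rintro ⟨g, -, -, hg, hn⟩
    rw [← hn 1, iteratedDeriv_one]
    exact hg 0
  · intro hf
    obtain ⟨h, hh, hd, h0⟩ := borel_exists f (f 1 / 2) (by positivity)
    have hdiff : Differentiable ℝ h := hh.differentiable (by simp)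
    have hL : ContDiff ℝ (⊤ : ℕ∞) (fun x : ℝ => f 0 + f 1 * x) := by fun_prop
    have hLd : deriv (fun x : ℝ => f 0 + f 1 * x) = fun _ => f 1 := by
      funext x
      simp
    let g : ℝ → ℝ := (fun x : ℝ => f 0 + f 1 * x) + h
    have hg : ContDiff ℝ (⊤ : ℕ∞) g := hL.add hh
    have hgd : Differentiable ℝ g := hg.differentiable (by simp)
    have hderiv : ∀ x, deriv g x = f 1 + deriv h x := by
      intro x
      rw [deriv_add (hL.differentiable (by simp) x) (hdiff x), hLd]
    have hge : ∀ x, f 1 / 2 ≤ deriv g x := by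
      intro x
      rw [hderiv]
      have := (abs_le.1 (hd x)).1
      linarith
    have hmono : Monotone (fun x => g x - f 1 / 2 * x) := by
      apply monotone_of_deriv_nonneg (by fun_prop)
      intro x
      have h1 := (hgd x).hasDerivAt.sub ((hasDerivAt_id x).const_mul (f 1 / 2))
      have h2 : deriv (fun x => g x - f 1 / 2 * x) x = deriv g x - f 1 / 2 * 1 := h1.deriv
      rw [h2]
      have := hge x
      linarith
    refine ⟨g, hg, ?_, fun x => lt_of_lt_of_le (by positivity) (hge x), ?_⟩
    · apply hg.continuous.surjective
      · refine Filter.tendsto_atTop_mono' _ ?_ (Filter.tendsto_atTop_add_const_right _ (g 0)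
          (Filter.tendsto_id.const_mul_atTop (half_pos hf)))
        filter_upwards [Filter.eventually_ge_atTop 0] with x hx
        have := hmono hx
        simp only [id] at *
        linarith
      · refine Filter.tendsto_atBot_mono' _ ?_ (Filter.tendsto_atBot_add_const_right _ (g 0)
          (Filter.tendsto_id.const_mul_atBot (half_pos hf)))
        filter_upwards [Filter.eventually_le_atBot 0] with x hx
        have := hmono hx
        simp only [id] at *
        linarith
    · intro n
      have e : iteratedDeriv n g 0 = iteratedDeriv n (fun x : ℝ => f 0 + f 1 * x) 0
          + iteratedDeriv n h 0 :=
        iteratedDeriv_add (hL.of_le (by exact_mod_cast le_top)).contDiffAt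
          (hh.of_le (by exact_mod_cast le_top)).contDiffAt
      rw [e, h0]
      match n with
      | 0 => simp
      | 1 => simp
      | n + 2 =>
        rw [iteratedDeriv_succ', hLd, iteratedDeriv_const]
        simp
end

section
/- Let n ≥ 1 be a natural number, let f, g ∈ D^n_+(ℝ), let a ∈ ℝ and b = f(a). If f^(k)(a) = g^(k)(a) for every natural number k ≤ n, then the inverse functions satisfy (f⁻¹)^(k)(b) = (g⁻¹)^(k)(b) for every natural number k ≤ n. -/
/-- `f ∈ D^n_+(ℝ)`: a surjective C^n function `f : ℝ → ℝ` with everywhere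
positive derivative, i.e. an orientation-preserving C^n diffeomorphism of ℝ. -/
def IsDiffeoPos (n : ℕ) (f : ℝ → ℝ) : Prop :=
  ContDiff ℝ n f ∧ Function.Surjective f ∧ ∀ x : ℝ, 0 < deriv f x

lemma jet_comp (n : ℕ) (u v p q : ℝ → ℝ) (x : ℝ)
    (hu : ContDiff ℝ n u) (hv : ContDiff ℝ n v) (hp : ContDiff ℝ n p) (hq : ContDiff ℝ n q)
    (huv : ∀ k : ℕ, k ≤ n → iteratedDeriv k u (p x) = iteratedDeriv k v (p x))
    (hpq : ∀ k : ℕ, k ≤ n → iteratedDeriv k p x = iteratedDeriv k q x) :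
    ∀ k : ℕ, k ≤ n → iteratedDeriv k (u ∘ p) x = iteratedDeriv k (v ∘ q) x := by
  intro k hk
  have h0 : p x = q x := by simpa using hpq 0 (Nat.zero_le n)
  have hk' : (k : WithTop ℕ∞) ≤ n := by exact_mod_cast hk
  rw [iteratedDeriv_comp_eq_sum_orderedFinpartition hu.contDiffAt hp.contDiffAt hk',
    iteratedDeriv_comp_eq_sum_orderedFinpartition hv.contDiffAt hq.contDiffAt hk']
  refine Finset.sum_congr rfl fun c _ => ?_
  rw [huv _ (c.length_le.trans hk), h0]
  congr 1
  refine Finset.prod_congr rfl fun j _ => ?_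
  exact hpq _ ((c.partSize_le j).trans hk)

lemma inv_facts (n : ℕ) (hn : 1 ≤ n) (f : ℝ → ℝ) (hf : IsDiffeoPos n f) :
    ContDiff ℝ n (Function.invFun f) ∧ Function.LeftInverse (Function.invFun f) f ∧
      Function.RightInverse (Function.invFun f) f := by
  obtain ⟨hc, hs, hd⟩ := hf
  have hm : StrictMono f := strictMono_of_deriv_pos hd
  have hl := Function.leftInverse_invFun hm.injective
  have hr := Function.rightInverse_invFun hs
  refine ⟨?_, hl, hr⟩
  let e : ℝ ≃ₜ ℝ := (hm.orderIsoOfSurjective f hs).toHomeomorph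
  have he : (e.symm : ℝ → ℝ) = Function.invFun f := by
    funext y
    apply hm.injective
    rw [hr y]
    exact e.apply_symm_apply y
  rw [← he]
  have hn' : (n : WithTop ℕ∞) ≠ 0 := by exact_mod_cast (by omega : n ≠ 0)
  exact e.contDiff_symm_deriv (f' := deriv f) (fun x => (hd x).ne')
    (fun x => (hc.differentiable hn' x).hasDerivAt) hc

/-- if the n-jets of `f, g ∈ D^n_+(ℝ)` agree at `a`, then the
n-jets of the inverse functions agree at `b = f a`. -/
theorem stmt_9 (n : ℕ) (hn : 1 ≤ n) (f g : ℝ → ℝ)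
    (hf : IsDiffeoPos n f) (hg : IsDiffeoPos n g)
    (a b : ℝ) (hb : b = f a)
    (hfg : ∀ k : ℕ, k ≤ n → iteratedDeriv k f a = iteratedDeriv k g a) :
    ∀ k : ℕ, k ≤ n →
      iteratedDeriv k (Function.invFun f) b = iteratedDeriv k (Function.invFun g) b := by
  obtain ⟨hF, hFl, hFr⟩ := inv_facts n hn f hf
  obtain ⟨hG, hGl, hGr⟩ := inv_facts n hn g hg
  have hFb : Function.invFun f b = a := by rw [hb]; exact hFl a
  have h1 := jet_comp n (Function.invFun g) (Function.invFun g) f g a hG hG hf.1 hg.1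
    (fun _ _ => rfl) hfg
  have h2 := jet_comp n (Function.invFun g ∘ f) (Function.invFun g ∘ g) (Function.invFun f)
    (Function.invFun f) b (hG.comp hf.1) (hG.comp hg.1) hF hF
    (by rw [hFb]; exact h1) (fun _ _ => rfl)
  intro k hk
  have h3 := h2 k hk
  have e1 : (Function.invFun g ∘ f) ∘ Function.invFun f = Function.invFun g := by
    funext y
    simp only [Function.comp_apply]
    rw [hFr y]
  have e2 : (Function.invFun g ∘ g) ∘ Function.invFun f = Function.invFun f := by
    funext y
    simp only [Function.comp_apply]
    exact hGl _
  rw [e1, e2] at h3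
  exact h3.symm
end

section
/- Let n ≥ 1 be a natural number, let f ∈ D^n_+(ℝ), and let a ∈ ℝ. Then the following are equivalent: (i) f^(k)(a) = id^(k)(a) for every natural number k ≤ n (i.e., f(a) = a, f'(a) = 1, and f^(k)(a) = 0 for 2 ≤ k ≤ n); (ii) (f⁻¹)^(k)(a) = id^(k)(a) for every natural number k ≤ n. -/
theorem flat_comp (n : ℕ) : ∀ (u g : ℝ → ℝ) (a : ℝ), ContDiff ℝ n u → ContDiff ℝ n g →
    (∀ k ≤ n, iteratedDeriv k u (g a) = 0) → ∀ k ≤ n, iteratedDeriv k (u ∘ g) a = 0 := by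
  induction n with
  | zero =>
    intro u g a _ _ h k hk
    obtain rfl : k = 0 := by omega
    simpa using h 0 le_rfl
  | succ n ih =>
    intro u g a hu hg h k hk
    rcases k with _ | k
    · simpa using h 0 (by omega)
    have hu1 : Differentiable ℝ u := hu.differentiable (by simp)
    have hg1 : Differentiable ℝ g := hg.differentiable (by simp)
    have hu' : ContDiff ℝ n (deriv u) := by
      push_cast at hu; exact (contDiff_succ_iff_deriv.1 hu).2.2
    have hg' : ContDiff ℝ n (deriv g) := by
      push_cast at hg; exact (contDiff_succ_iff_deriv.1 hg).2.2
    have hgn : ContDiff ℝ n g := hg.of_le (by exact_mod_cast Nat.le_succ n)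
    have hd : deriv (u ∘ g) = (deriv u ∘ g) * deriv g := by
      ext x
      exact deriv_comp x (hu1 _) (hg1 _)
    have hkn : k ≤ n := by omega
    have hkn' : (k : WithTop ℕ∞) ≤ n := by exact_mod_cast hkn
    rw [iteratedDeriv_succ', hd, iteratedDeriv_mul
      ((hu'.comp hgn).of_le hkn').contDiffAt (hg'.of_le hkn').contDiffAt]
    refine Finset.sum_eq_zero fun i hi => ?_
    have hi' : i ≤ n := by have := Finset.mem_range.1 hi; omega
    rw [ih (deriv u) g a hu' hgn
      (fun j hj => by rw [← iteratedDeriv_succ']; exact h _ (by omega)) i hi']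
    simp

theorem jet_inv (n : ℕ) (f g : ℝ → ℝ) (a : ℝ) (hf : ContDiff ℝ n f) (hg : ContDiff ℝ n g)
    (hfg : ∀ y, f (g y) = y) (hgf : ∀ y, g (f y) = y)
    (h : ∀ k ≤ n, iteratedDeriv k f a = iteratedDeriv k (id : ℝ → ℝ) a) :
    ∀ k ≤ n, iteratedDeriv k g a = iteratedDeriv k (id : ℝ → ℝ) a := by
  have hfa : f a = a := by simpa using h 0 (Nat.zero_le _)
  have hga : g a = a := by have := hgf a; rwa [hfa] at this
  intro k hk
  have hkn' : (k : WithTop ℕ∞) ≤ n := by exact_mod_cast hk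
  have key := flat_comp n (f - id) g a (hf.sub contDiff_id) hg (fun j hj => by
    have hj' : (j : WithTop ℕ∞) ≤ n := by exact_mod_cast hj
    rw [hga, iteratedDeriv_sub (hf.of_le hj').contDiffAt contDiff_id.contDiffAt, h j hj, sub_self])
    k hk
  have e : (f - id) ∘ g = id - g := by
    ext x; simp [hfg]
  rw [e, iteratedDeriv_sub contDiff_id.contDiffAt (hg.of_le hkn').contDiffAt] at key
  linarith

/-- the n-jet of `f` at `a` equals the n-jet of the identity iff
the n-jet of `f⁻¹` at `a` equals the n-jet of the identity. -/
theorem stmt_10 (n : ℕ) (hn : 1 ≤ n) (f : ℝ → ℝ) (hf : IsDiffeoPos n f) (a : ℝ) :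
    (∀ k : ℕ, k ≤ n → iteratedDeriv k f a = iteratedDeriv k (id : ℝ → ℝ) a) ↔
      (∀ k : ℕ, k ≤ n →
        iteratedDeriv k (Function.invFun f) a = iteratedDeriv k (id : ℝ → ℝ) a) := by
  obtain ⟨hc, hs, hp⟩ := hf
  have hm : StrictMono f := strictMono_of_deriv_pos hp
  have hfg : ∀ y, f (Function.invFun f y) = y := Function.rightInverse_invFun hs
  have hgf : ∀ y, Function.invFun f (f y) = y := Function.leftInverse_invFun hm.injective
  have hd : Differentiable ℝ f := hc.differentiable (by
    have : n ≠ 0 := by omega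
    exact_mod_cast this)
  let e : ℝ ≃ₜ ℝ := (hm.orderIsoOfSurjective f hs).toHomeomorph
  have he : ∀ x, e x = f x := fun x => rfl
  have hes : (e.symm : ℝ → ℝ) = Function.invFun f := by
    ext y
    apply e.injective
    rw [e.apply_symm_apply, he, hfg]
  have hg : ContDiff ℝ n (Function.invFun f) := by
    rw [← hes]
    exact e.contDiff_symm_deriv (f' := deriv f) (fun x => (hp x).ne')
      (fun x => (hd x).hasDerivAt) hc
  exact ⟨jet_inv n f _ a hc hg hfg hgf, jet_inv n _ f a hg hc hgf hfg⟩
end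

section
/- Let n ≥ 1 be a natural number, let f, φ ∈ D^n_+(ℝ), and let a ∈ ℝ. Then (φ ∘ f)^(k)(a) = φ^(k)(a) for every natural number k ≤ n if and only if f^(k)(a) = id^(k)(a) for every natural number k ≤ n (i.e., f(a) = a, f'(a) = 1, and f^(k)(a) = 0 for 2 ≤ k ≤ n). -/
open Asymptotics Filter Topology in
theorem jet_zero_iff (n : ℕ) (g : ℝ → ℝ) (hg : ContDiff ℝ n g) (a : ℝ) :
    (∀ k : ℕ, k ≤ n → iteratedDeriv k g a = 0) ↔ g =o[𝓝 a] fun x => (x - a) ^ n := by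
  constructor
  · intro h
    have h1 := taylor_isLittleO_univ (x₀ := a) hg
    refine h1.congr_left fun x => ?_
    rw [taylor_within_apply, Finset.sum_eq_zero, sub_zero]
    intro k hk
    rw [iteratedDerivWithin_univ, h k (by simpa [Nat.lt_succ_iff] using hk), smul_zero]
  · intro h k
    induction k using Nat.strong_induction_on with
    | _ k ih =>
    intro hk
    have h1 := taylor_isLittleO_univ (x₀ := a) (n := k) (hg.of_le (by exact_mod_cast hk))
    have h2 : g =o[𝓝 a] fun x => (x - a) ^ k := by
      refine h.trans_isBigO ?_
      have h3 : (fun x : ℝ => (x - a) ^ (n - k)) =O[𝓝 a] fun _ => (1 : ℝ) :=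
        Filter.Tendsto.isBigO_one ℝ (ContinuousAt.tendsto (by fun_prop))
      refine ((isBigO_refl (fun x : ℝ => (x - a) ^ k) (𝓝 a)).mul h3).congr (fun x => ?_)
        (fun x => mul_one _)
      rw [← pow_add]; congr 1; omega
    have h4 := h2.sub h1
    have h5 : (fun x => (((k.factorial : ℝ)⁻¹) * iteratedDeriv k g a) * (x - a) ^ k)
        =o[𝓝 a] fun x => (x - a) ^ k := by
      refine h4.congr_left fun x => ?_
      rw [taylor_within_apply, Finset.sum_range_succ, Finset.sum_eq_zero]
      · simp only [iteratedDerivWithin_univ, smul_eq_mul]; ring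
      · intro j hj
        have hj := Finset.mem_range.1 hj
        rw [iteratedDerivWithin_univ, ih j hj (by omega), smul_zero]
    by_contra hne
    have hc : ((k.factorial : ℝ)⁻¹) * iteratedDeriv k g a ≠ 0 :=
      mul_ne_zero (by positivity) hne
    rw [isLittleO_const_mul_left_iff hc] at h5
    refine isLittleO_irrefl ?_ h5
    have : ∃ᶠ x in 𝓝[≠] a, (x - a) ^ k ≠ 0 := by
      refine Eventually.frequently ?_
      filter_upwards [self_mem_nhdsWithin] with x hx
      exact pow_ne_zero _ (sub_ne_zero.2 hx)
    exact this.filter_mono nhdsWithin_le_nhds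

open Asymptotics Filter Topology in
theorem jet_eq_iff (n : ℕ) (u v : ℝ → ℝ) (hu : ContDiff ℝ n u) (hv : ContDiff ℝ n v) (a : ℝ) :
    (∀ k : ℕ, k ≤ n → iteratedDeriv k u a = iteratedDeriv k v a) ↔
      (fun x => u x - v x) =o[𝓝 a] fun x => (x - a) ^ n := by
  rw [← jet_zero_iff n _ (hu.sub hv)]
  refine forall₂_congr fun k hk => ?_
  have hk' : (k : WithTop ℕ∞) ≤ n := by exact_mod_cast hk
  have := iteratedDeriv_sub (x := a) (hu.of_le hk').contDiffAt (hv.of_le hk').contDiffAt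
  change _ ↔ iteratedDeriv k (u - v) a = 0
  rw [this, sub_eq_zero]

open Asymptotics Filter Topology in
/-- the n-jet of `φ ∘ f` at `a` equals the n-jet of `φ` iff the
n-jet of `f` at `a` equals the n-jet of the identity. -/
theorem stmt_11 (n : ℕ) (hn : 1 ≤ n) (f φ : ℝ → ℝ)
    (hf : IsDiffeoPos n f) (hφ : IsDiffeoPos n φ) (a : ℝ) :
    (∀ k : ℕ, k ≤ n → iteratedDeriv k (φ ∘ f) a = iteratedDeriv k φ a) ↔
      (∀ k : ℕ, k ≤ n → iteratedDeriv k f a = iteratedDeriv k (id : ℝ → ℝ) a) := by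
  have key : f a = a → ((∀ k : ℕ, k ≤ n → iteratedDeriv k (φ ∘ f) a = iteratedDeriv k φ a) ↔
      (∀ k : ℕ, k ≤ n → iteratedDeriv k f a = iteratedDeriv k (id : ℝ → ℝ) a)) := by
    intro ha
    rw [jet_eq_iff n _ _ (hφ.1.comp hf.1) hφ.1, jet_eq_iff n _ _ hf.1 contDiff_id]
    have hs : HasStrictDerivAt φ (deriv φ a) a :=
      hφ.1.contDiffAt.hasStrictDerivAt (by exact_mod_cast (by omega : n ≠ 0))
    have ht := HasDerivAtFilter.isTheta_sub hs (hφ.2.2 a).ne'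
    have hfc : Tendsto (fun x => (f x, x)) (𝓝 a) (𝓝 (a, a)) := by
      have : ContinuousAt (fun x => (f x, x)) a :=
        (hf.1.continuous.prodMk continuous_id).continuousAt
      simpa [ContinuousAt, ha] using this
    exact IsTheta.isLittleO_congr_left ⟨ht.1.comp_tendsto hfc, ht.2.comp_tendsto hfc⟩
  constructor
  · intro h
    have h0 := h 0 (Nat.zero_le _)
    simp only [iteratedDeriv_zero, Function.comp] at h0
    exact (key ((strictMono_of_deriv_pos hφ.2.2).injective h0)).1 h
  · intro h
    have h0 := h 0 (Nat.zero_le _)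
    simp only [iteratedDeriv_zero, id] at h0
    exact (key h0).2 h
end

section
/- Let p : ℕ → ℝ be a sequence with p(1) > 0, and let u ∈ ℝ with p(0) < u. Then there exists a C^∞ function h : ℝ → ℝ such that h'(x) > 0 for all x ∈ ℝ, h^(n)(0) = p(n) for every n ∈ ℕ, and the range of h is the open ray (−∞, (p(0) + u)/2). -/
open Set Filter Topology in
lemma borel_aux (a : ℕ → ℝ) : ∃ f : ℝ → ℝ, ContDiff ℝ (⊤ : ℕ∞) f ∧
    ∀ n, iteratedDeriv n f 0 = a n := by
  let χ : ContDiffBump (0:ℝ) := ⟨1, 2, one_pos, one_lt_two⟩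
  let φ : ℕ → ℝ → ℝ := fun n y => y ^ n * χ y
  have hφ : ∀ n, ContDiff ℝ (⊤ : ℕ∞) (φ n) := fun n =>
    (contDiff_id.pow n).mul χ.contDiff
  have hφs : ∀ n, HasCompactSupport (φ n) := fun n => χ.hasCompactSupport.mul_left
  have hB : ∀ n k, ∃ B : ℝ, ∀ x, ‖iteratedDeriv k (φ n) x‖ ≤ B := by
    intro n k
    have h1 : HasCompactSupport (iteratedFDeriv ℝ k (φ n)) := (hφs n).iteratedFDeriv k
    obtain ⟨B, hB⟩ := ((hφ n).continuous_iteratedFDeriv (m := k)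
      (by exact_mod_cast le_top)).bounded_above_of_compact_support h1
    exact ⟨B, fun x => by rw [← norm_iteratedFDeriv_eq_norm_iteratedDeriv]; exact hB x⟩
  choose B hB using hB
  have hB0 : ∀ n k, 0 ≤ B n k := fun n k => (norm_nonneg _).trans (hB n k 0)
  let M : ℕ → ℝ := fun n => ∑ k ∈ Finset.range (n+1), B n k
  have hM : ∀ n k, k ≤ n → B n k ≤ M n := fun n k hk =>
    Finset.single_le_sum (f := fun k => B n k) (fun i _ => hB0 n i) (Finset.mem_range.2 (by omega))
  have hM0 : ∀ n, 0 ≤ M n := fun n => Finset.sum_nonneg (fun i _ => hB0 n i)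
  let L : ℕ → ℝ := fun n => 1 + 2 ^ n * (|a n| * M n)
  have hL1 : ∀ n, 1 ≤ L n := fun n => by
    have := hM0 n
    have : 0 ≤ 2 ^ n * (|a n| * M n) := by positivity
    simp only [L]; linarith
  have hL0 : ∀ n, 0 < L n := fun n => one_pos.trans_le (hL1 n)
  let c : ℕ → ℝ := fun n => a n / (n.factorial * L n ^ n)
  let f : ℕ → ℝ → ℝ := fun n x => c n * φ n (L n * x)
  have hf : ∀ n, ContDiff ℝ (⊤ : ℕ∞) (f n) := fun n =>
    contDiff_const.mul ((hφ n).comp (contDiff_const.mul contDiff_id))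
  have hder : ∀ n k x, iteratedDeriv k (f n) x = c n * (L n ^ k * iteratedDeriv k (φ n) (L n * x)) := by
    intro n k x
    have hk : ContDiff ℝ k (φ n) := (hφ n).of_le (by exact_mod_cast le_top)
    have h2 := iteratedDeriv_comp_const_mul hk (L n)
    simp only [f]
    rw [iteratedDeriv_const_mul_field, h2]
  let v : ℕ → ℕ → ℝ := fun k n => |c n| * (L n ^ k * B n k)
  have hv : ∀ k n x, ‖iteratedFDeriv ℝ k (f n) x‖ ≤ v k n := by
    intro k n x
    rw [norm_iteratedFDeriv_eq_norm_iteratedDeriv, hder, norm_mul, norm_mul, Real.norm_eq_abs,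
      Real.norm_of_nonneg (pow_nonneg (hL0 n).le k)]
    have := hL0 n
    have := hB n k (L n * x)
    simp only [v]
    gcongr
  have hvs : ∀ k, Summable (v k) := by
    intro k
    refine Summable.of_norm_bounded_eventually_nat (summable_geometric_of_lt_one (r := (1/2:ℝ)) (by norm_num) (by norm_num)) ?_
    filter_upwards [eventually_gt_atTop k] with n hn
    have hl := hL0 n
    have hb := hB0 n k
    rw [Real.norm_of_nonneg (by simp only [v]; positivity)]
    obtain ⟨j, rfl⟩ := Nat.exists_eq_add_of_lt hn
    set n := k + j + 1 with hn'
    have h1 : |c n| ≤ |a n| / L n ^ n := by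
      simp only [c]
      rw [abs_div, abs_of_pos (by positivity : 0 < (n.factorial : ℝ) * L n ^ n)]
      gcongr
      have : (1:ℝ) ≤ n.factorial := by exact_mod_cast Nat.factorial_pos n
      nlinarith [pow_pos hl n]
    have h2 : L n ^ (k+1) ≤ L n ^ n := pow_le_pow_right₀ (hL1 n) (by omega)
    have hm := hM n k (by omega)
    have hm0 := hM0 n
    calc v k n ≤ |a n| / L n ^ (k+1) * (L n ^ k * M n) := by
          simp only [v]
          gcongr
          refine h1.trans ?_
          gcongr
      _ = (|a n| * M n) / L n := by
          rw [pow_succ]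
          field_simp
      _ ≤ (1/2)^n := by
          rw [div_le_iff₀ hl, one_div, inv_pow, inv_mul_eq_div, le_div_iff₀ (by positivity)]
          simp only [L]
          linarith
  refine ⟨fun x => ∑' n, f n x, ?_, ?_⟩
  · exact contDiff_tsum hf (fun k _ => hvs k) (fun k n x _ => hv k n x)
  · intro k
    have h1 := iteratedFDeriv_tsum_apply (N := (⊤:ℕ∞)) hf (fun k _ => hvs k) (fun k n x _ => hv k n x)
      (k := k) le_top 0
    have hs : Summable (fun n => iteratedFDeriv ℝ k (f n) 0) :=
      Summable.of_norm_bounded (hvs k) (fun n => hv k n 0)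
    rw [iteratedDeriv_eq_iteratedFDeriv, h1, ContinuousMultilinearMap.tsum_eval hs]
    simp_rw [← iteratedDeriv_eq_iteratedFDeriv]
    have h3 : ∀ n, iteratedDeriv k (f n) 0 = if n = k then a k else 0 := by
      intro n
      have he : f n =ᶠ[𝓝 0] fun x => (a n / n.factorial) * x ^ n := by
        have ht : Tendsto (fun x : ℝ => L n * x) (𝓝 0) (𝓝 0) := by
          have : Continuous (fun x : ℝ => L n * x) := by fun_prop
          simpa using this.tendsto 0
        filter_upwards [ht.eventually χ.eventuallyEq_one] with x hx
        simp only [f, φ, c]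
        rw [hx]
        have := hL0 n
        have := n.factorial_pos
        simp only [Pi.one_apply]
        rw [mul_pow]
        field_simp
      rw [he.iteratedDeriv_eq, iteratedDeriv_const_mul_field, iteratedDeriv_fun_pow_zero]
      have := n.factorial_ne_zero
      by_cases h : n = k
      · subst h; simp; field_simp
      · have h' : k ≠ n := fun e => h e.symm
        simp [h, h']
    simp_rw [h3]
    simp

open Set Filter Topology in
lemma cutoff_aux (f : ℝ → ℝ) (hf : ContDiff ℝ (⊤ : ℕ∞) f) (h0 : 0 < f 0) :
    ∃ F : ℝ → ℝ, ContDiff ℝ (⊤ : ℕ∞) F ∧ (∃ m > 0, ∀ x, m ≤ F x) ∧ F =ᶠ[𝓝 0] f := by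
  obtain ⟨m, hm, hm'⟩ : ∃ m > 0, 2 * m < f 0 := ⟨f 0 / 3, by positivity, by linarith⟩
  refine ⟨fun x => m + Real.smoothTransition (f x / m - 1) * (f x - m), ?_, ⟨m, hm, ?_⟩, ?_⟩
  · exact contDiff_const.add ((Real.smoothTransition.contDiff.comp
      ((hf.div_const m).sub contDiff_const)).mul (hf.sub contDiff_const))
  · intro x
    beta_reduce
    rcases le_total (f x) m with h | h
    · rw [Real.smoothTransition.zero_of_nonpos]
      · simp
      · rw [sub_nonpos, div_le_one hm]; exact h
    · have := mul_nonneg (Real.smoothTransition.nonneg (f x / m - 1)) (sub_nonneg.2 h)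
      linarith
  · filter_upwards [hf.continuous.continuousAt.eventually (lt_mem_nhds hm')] with x hx
    rw [Real.smoothTransition.one_of_one_le]
    · ring
    · rw [le_sub_iff_add_le, le_div_iff₀ hm]; linarith

open Set Filter Topology in
/-- a smooth strictly increasing function with prescribed jet at
`0` and range `(−∞, (p 0 + u)/2)`. -/
theorem stmt_12 (p : ℕ → ℝ) (hp : 0 < p 1) (u : ℝ) (hu : p 0 < u) :
    ∃ h : ℝ → ℝ, ContDiff ℝ (⊤ : ℕ∞) h ∧
      (∀ x : ℝ, 0 < deriv h x) ∧
      (∀ n : ℕ, iteratedDeriv n h 0 = p n) ∧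
      Set.range h = Set.Iio ((p 0 + u) / 2) := by
  obtain ⟨c, hc⟩ : ∃ c, c = (p 0 + u) / 2 := ⟨_, rfl⟩
  rw [← hc]
  obtain ⟨h₀, hh₀, hj⟩ := borel_aux p
  have e0 : h₀ 0 = p 0 := by simpa using hj 0
  have e1 : deriv h₀ 0 = p 1 := by simpa using hj 1
  obtain ⟨D, hD, ⟨m, hm, hmD⟩, hDe⟩ := cutoff_aux (fun x => c - h₀ x) (contDiff_const.sub hh₀)
    (by simp only [e0]; linarith)
  have hDpos : ∀ x, 0 < D x := fun x => hm.trans_le (hmD x)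
  let k₁ : ℝ → ℝ := fun x => - Real.log (D x)
  have hk₁ : ContDiff ℝ (⊤ : ℕ∞) k₁ := (hD.log (fun x => (hDpos x).ne')).neg
  have hdk₁ : ContDiff ℝ (⊤ : ℕ∞) (deriv k₁) := (contDiff_infty_iff_deriv.1 hk₁).2
  have hd0 : 0 < deriv k₁ 0 := by
    have hD' : HasDerivAt D (-p 1) 0 := by
      have : HasDerivAt h₀ (p 1) 0 := e1 ▸ (hh₀.differentiable (by simp) 0).hasDerivAt
      exact (this.const_sub c).congr_of_eventuallyEq hDe
    have h2 := (hD'.log (hDpos 0).ne').neg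
    have h3 : deriv k₁ 0 = -(-p 1 / D 0) := h2.deriv
    rw [h3, neg_div, neg_neg]
    exact div_pos hp (hDpos 0)
  obtain ⟨w, hw, ⟨r, hr, hrw⟩, hwe⟩ := cutoff_aux _ hdk₁ hd0
  let k : ℝ → ℝ := fun x => k₁ 0 + ∫ t in (0:ℝ)..x, w t
  have hkd : ∀ x, HasDerivAt k (w x) x := fun x =>
    (intervalIntegral.integral_hasDerivAt_right (hw.continuous.intervalIntegrable _ _)
      (hw.continuous.stronglyMeasurableAtFilter _ _) hw.continuous.continuousAt).const_add _
  have hk : ContDiff ℝ (⊤ : ℕ∞) k := by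
    rw [contDiff_infty_iff_deriv]
    refine ⟨fun x => (hkd x).differentiableAt, ?_⟩
    rw [show deriv k = w from funext fun x => (hkd x).deriv]
    exact hw
  have hke : k =ᶠ[𝓝 0] k₁ := by
    obtain ⟨ε, hε, hball⟩ := Metric.eventually_nhds_iff_ball.1 hwe
    filter_upwards [Metric.ball_mem_nhds 0 hε] with x hx
    refine Metric.isOpen_ball.eqOn_of_deriv_eq (convex_ball (0:ℝ) ε).isPreconnected
      (fun y _ => (hkd y).differentiableAt.differentiableWithinAt)
      (fun y _ => (hk₁.differentiable (by simp) y).differentiableWithinAt)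
      (fun y hy => by rw [(hkd y).deriv, hball y hy]) (Metric.mem_ball_self hε) (by simp [k]) hx
  have hmono : Monotone (fun x => k x - r * x) := by
    have hd : ∀ x, HasDerivAt (fun x => k x - r * x) (w x - r) x := fun x => by
      simpa using (hkd x).fun_sub ((hasDerivAt_id x).const_mul r)
    refine monotone_of_deriv_nonneg (fun x => (hd x).differentiableAt) (fun x => ?_)
    rw [(hd x).deriv]; linarith [hrw x]
  have hsurj : Function.Surjective k := by
    refine hk.continuous.surjective ?_ ?_
    · refine tendsto_atTop_mono' atTop ?_ (tendsto_atTop_add_const_left _ (k 0)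
        (tendsto_id.const_mul_atTop hr))
      filter_upwards [eventually_ge_atTop 0] with x hx
      have := hmono hx
      simp at this ⊢; linarith
    · refine tendsto_atBot_mono' atBot ?_ (tendsto_atBot_add_const_left _ (k 0)
        (tendsto_id.const_mul_atBot hr))
      filter_upwards [eventually_le_atBot 0] with x hx
      have := hmono hx
      simp at this ⊢; linarith
  have hhd : ∀ x, HasDerivAt (fun x => c - Real.exp (-k x)) (Real.exp (-k x) * w x) x := fun x => by
    have := ((hkd x).neg.exp).const_sub c
    simpa using this
  refine ⟨fun x => c - Real.exp (-k x), contDiff_const.sub hk.neg.exp, ?_, ?_, ?_⟩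
  · intro x
    rw [(hhd x).deriv]
    exact mul_pos (Real.exp_pos _) (hr.trans_le (hrw x))
  · intro n
    rw [← hj n]
    refine Filter.EventuallyEq.iteratedDeriv_eq n ?_
    filter_upwards [hke, hDe] with x hx hx'
    rw [hx]
    simp only [k₁, neg_neg]
    rw [Real.exp_log (hDpos x), hx']
    ring
  · ext y
    simp only [mem_range, mem_Iio]
    constructor
    · rintro ⟨x, rfl⟩
      linarith [Real.exp_pos (-k x)]
    · intro hy
      obtain ⟨x, hx⟩ := hsurj (-Real.log (c - y))
      refine ⟨x, ?_⟩
      rw [hx, neg_neg, Real.exp_log (by linarith)]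
      ring
end

section
/- Let q : ℕ → ℝ be a sequence with q(1) > 0, and let u ∈ ℝ with u < q(0). Then there exists a C^∞ function h : ℝ → ℝ such that h'(x) > 0 for all x ∈ ℝ, h^(n)(1) = q(n) for every n ∈ ℕ, and the range of h is the open ray ((u + q(0))/2, +∞). -/
open Filter Topology in
theorem borel_zero (a : ℕ → ℝ) : ∃ f : ℝ → ℝ, ContDiff ℝ (⊤ : ℕ∞) f ∧
    ∀ n : ℕ, iteratedDeriv n f 0 = a n := by
  let χ : ContDiffBump (0 : ℝ) := ⟨1, 2, by norm_num, by norm_num⟩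
  let φ : ℕ → ℝ → ℝ := fun i y => y ^ i * χ y
  have hφ : ∀ i, ContDiff ℝ (⊤ : ℕ∞) (φ i) := fun i =>
    (contDiff_id.pow i).mul χ.contDiff
  have hφk : ∀ i (k : ℕ), ContDiff ℝ k (φ i) := fun i k => (hφ i).of_le (by exact_mod_cast le_top)
  have hφc : ∀ i, HasCompactSupport (φ i) := fun i => χ.hasCompactSupport.mul_left
  have hC : ∀ k i, ∃ C : ℝ, ∀ x, ‖iteratedDeriv k (φ i) x‖ ≤ C := by
    intro k i
    obtain ⟨C, hC⟩ := ((hφc i).iteratedFDeriv (𝕜 := ℝ) k).exists_bound_of_continuous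
      ((hφk i k).continuous_iteratedFDeriv le_rfl)
    exact ⟨C, fun x => by rw [← norm_iteratedFDeriv_eq_norm_iteratedDeriv]; exact hC x⟩
  choose C hC using hC
  have hC0 : ∀ k i, 0 ≤ C k i := fun k i => (norm_nonneg _).trans (hC k i 0)
  let b : ℕ → ℝ := fun i => a i / (i.factorial : ℝ)
  let M : ℕ → ℝ := fun i => ∑ k ∈ Finset.range (i + 1), C k i
  have hM0 : ∀ i, 0 ≤ M i := fun i => Finset.sum_nonneg fun k _ => hC0 k i
  let l : ℕ → ℝ := fun i => 1 + 2 ^ i * (|b i| * M i)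
  have hl : ∀ i, 1 ≤ l i := fun i => by
    have := hM0 i
    have : 0 ≤ 2 ^ i * (|b i| * M i) := by positivity
    simp only [l]; linarith
  have hl0 : ∀ i, 0 < l i := fun i => by linarith [hl i]
  let t : ℕ → ℝ → ℝ := fun i x => (b i * (l i ^ i)⁻¹) * φ i (l i * x)
  have ht : ∀ i, ContDiff ℝ (⊤ : ℕ∞) (t i) := fun i =>
    contDiff_const.mul ((hφ i).comp (contDiff_const.mul contDiff_id))
  have htd : ∀ k i x, iteratedDeriv k (t i) x =
      (b i * (l i ^ i)⁻¹) * (l i ^ k * iteratedDeriv k (φ i) (l i * x)) := by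
    intro k i x
    have h1 := congrFun (iteratedDeriv_comp_const_mul (hφk i k) (l i)) x
    simp only [t]
    rw [iteratedDeriv_const_mul_field, h1]
  let v : ℕ → ℕ → ℝ := fun k i => if k < i then (1 / 2) ^ i
    else |b i * (l i ^ i)⁻¹| * (l i ^ k * C k i)
  have hv : ∀ k, Summable (v k) := by
    intro k
    rw [← summable_nat_add_iff (k + 1)]
    have : (fun n => v k (n + (k + 1))) = fun n => (1 / 2 : ℝ) ^ (n + (k + 1)) := by
      funext n
      simp only [v]; rw [if_pos (by omega)]
    rw [this, summable_nat_add_iff (f := fun n => (1 / 2 : ℝ) ^ n) (k + 1)]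
    exact summable_geometric_two
  have hb : ∀ (k i : ℕ) (x : ℝ), ‖iteratedFDeriv ℝ k (t i) x‖ ≤ v k i := by
    intro k i x
    rw [norm_iteratedFDeriv_eq_norm_iteratedDeriv, htd, norm_mul, norm_mul (l i ^ k),
      Real.norm_eq_abs (l i ^ k), abs_of_pos (pow_pos (hl0 i) k), Real.norm_eq_abs]
    have h0 : |b i * (l i ^ i)⁻¹| * (l i ^ k * ‖iteratedDeriv k (φ i) (l i * x)‖) ≤
        |b i * (l i ^ i)⁻¹| * (l i ^ k * C k i) := by
      have := hl0 i
      gcongr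
      exact hC k i _
    refine h0.trans ?_
    simp only [v]
    split_ifs with hki
    · have hCM : C k i ≤ M i := Finset.single_le_sum (f := fun k => C k i)
        (fun k _ => hC0 k i) (Finset.mem_range.2 (by omega))
      have hp : l i ^ (k + 1) ≤ l i ^ i := pow_le_pow_right₀ (hl i) hki
      have hli := hl0 i
      have h2 : 2 ^ i * (|b i| * C k i) ≤ l i := by
        have : 2 ^ i * (|b i| * C k i) ≤ 2 ^ i * (|b i| * M i) := by gcongr
        simp only [l]; linarith
      rw [abs_mul, abs_of_pos (inv_pos.2 (pow_pos hli i)), one_div, inv_pow]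
      rw [show |b i| * (l i ^ i)⁻¹ * (l i ^ k * C k i) = (|b i| * C k i * l i ^ k) / l i ^ i by
        field_simp]
      rw [div_le_iff₀ (pow_pos hli i), inv_mul_eq_div, le_div_iff₀ (by positivity)]
      calc |b i| * C k i * l i ^ k * 2 ^ i = (2 ^ i * (|b i| * C k i)) * l i ^ k := by ring
        _ ≤ l i * l i ^ k := by gcongr
        _ = l i ^ (k + 1) := by ring
        _ ≤ _ := hp
    · exact le_rfl
  refine ⟨fun x => ∑' i, t i x, contDiff_tsum ht (fun k _ => hv k) (fun k i x _ => hb k i x), ?_⟩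
  intro n
  have hz : ∀ i, iteratedDeriv n (t i) 0 = if i = n then a n else 0 := by
    intro i
    have he : φ i =ᶠ[𝓝 0] fun y => y ^ i := by
      filter_upwards [χ.eventuallyEq_one] with y hy
      simp only [φ, hy, Pi.one_apply, mul_one]
    rw [htd, mul_zero, he.iteratedDeriv_eq, iteratedDeriv_fun_pow_zero]
    have := hl0 i
    by_cases h : i = n
    · subst h
      simp only [b]
      have := Nat.factorial_ne_zero i
      simp
      field_simp
    · simp [h, Ne.symm h]
  have hs : Summable fun i => iteratedFDeriv ℝ n (t i) 0 :=
    .of_norm_bounded (hv n) fun i => hb n i 0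
  rw [iteratedDeriv_eq_iteratedFDeriv, iteratedFDeriv_tsum_apply (N := ⊤) ht (fun k _ => hv k)
    (fun k i x _ => hb k i x) le_top, ContinuousMultilinearMap.tsum_eval hs]
  simp only [← iteratedDeriv_eq_iteratedFDeriv, hz]
  simp

/-- a smooth strictly increasing function with prescribed jet at
`1` and range `((u + q 0)/2, +∞)`. -/
theorem stmt_13 (q : ℕ → ℝ) (hq : 0 < q 1) (u : ℝ) (hu : u < q 0) :
    ∃ h : ℝ → ℝ, ContDiff ℝ (⊤ : ℕ∞) h ∧
      (∀ x : ℝ, 0 < deriv h x) ∧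
      (∀ n : ℕ, iteratedDeriv n h 1 = q n) ∧
      Set.range h = Set.Ioi ((u + q 0) / 2) := by
  obtain ⟨p0, hp0, hp0d⟩ := borel_zero q
  obtain ⟨p, hp, hpd⟩ : ∃ p : ℝ → ℝ, ContDiff ℝ (⊤ : ℕ∞) p ∧ ∀ n : ℕ, iteratedDeriv n p 1 = q n := by
    refine ⟨fun x => p0 (x - 1), hp0.comp (contDiff_id.sub contDiff_const), fun n => ?_⟩
    have := congrFun (iteratedDeriv_comp_sub_const n p0 1) 1
    rw [this]; simp [hp0d]
  clear hp0d hp0 p0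
  obtain ⟨c, hc⟩ : ∃ c, c = (u + q 0) / 2 := ⟨_, rfl⟩
  rw [← hc]
  have hcq : c < q 0 := by rw [hc]; linarith
  have hp1 : p 1 = q 0 := by simpa using hpd 0
  have hdp1 : deriv p 1 = q 1 := by simpa using hpd 1
  have hdp : ContDiff ℝ (⊤ : ℕ∞) (deriv p) := (contDiff_infty_iff_deriv.1 hp).2
  have hev : ∀ᶠ x in nhds (1 : ℝ), 0 < p x - c ∧ 0 < deriv p x := by
    refine Filter.Eventually.and ?_ ?_
    · exact (hp.continuous.sub continuous_const).continuousAt.eventually_const_lt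
        (show 0 < p 1 - c by rw [hp1]; linarith)
    · exact hdp.continuous.continuousAt.eventually_const_lt (by rw [hdp1]; exact hq)
  obtain ⟨r, hr, hball⟩ := Metric.eventually_nhds_iff_ball.1 hev
  let χ : ContDiffBump (1 : ℝ) := ⟨r / 3, r / 2, by linarith, by linarith⟩
  let k : ℝ → ℝ := fun x => χ x * Real.log (deriv p x / (p x - c))
  have hk : ContDiff ℝ (⊤ : ℕ∞) k := by
    rw [contDiff_iff_contDiffAt]
    intro x
    by_cases hx : x ∈ Metric.ball (1 : ℝ) r
    · obtain ⟨h1, h2⟩ := hball x hx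
      exact χ.contDiffAt.mul ((hdp.contDiffAt.div (hp.contDiffAt.sub contDiffAt_const) h1.ne').log
        (div_pos h2 h1).ne')
    · have : k =ᶠ[nhds x] fun _ => 0 := by
        have hxs : x ∉ tsupport χ := by
          rw [χ.tsupport_eq]
          intro h
          have h : dist x 1 ≤ r / 2 := h
          exact hx (Metric.mem_ball.2 (by linarith))
        filter_upwards [notMem_tsupport_iff_eventuallyEq.1 hxs] with y hy
        simp only [k, hy, Pi.zero_apply, zero_mul]
      exact contDiffAt_const.congr_of_eventuallyEq this
  have hkc : HasCompactSupport k := χ.hasCompactSupport.mul_right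
  obtain ⟨B, hB⟩ := hkc.exists_bound_of_continuous hk.continuous
  have hek : Continuous fun x => Real.exp (k x) := Real.continuous_exp.comp hk.continuous
  let g : ℝ → ℝ := fun x => Real.log (p 1 - c) + ∫ y in (1 : ℝ)..x, Real.exp (k y)
  have hg' : ∀ x, HasDerivAt g (Real.exp (k x)) x := fun x =>
    (hek.integral_hasStrictDerivAt 1 x).hasDerivAt.const_add _
  have hgd : deriv g = fun x => Real.exp (k x) := funext fun x => (hg' x).deriv
  have hg : ContDiff ℝ (⊤ : ℕ∞) g := by
    refine contDiff_infty_iff_deriv.2 ⟨fun x => (hg' x).differentiableAt, ?_⟩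
    rw [hgd]; exact hk.exp
  have hh' : ∀ x, HasDerivAt (fun x => c + Real.exp (g x)) (Real.exp (g x) * Real.exp (k x)) x :=
    fun x => (hg' x).exp.const_add c
  refine ⟨fun x => c + Real.exp (g x), contDiff_const.add hg.exp, fun x => ?_, fun n => ?_, ?_⟩
  · rw [(hh' x).deriv]; positivity
  · rw [← hpd n]
    apply Filter.EventuallyEq.iteratedDeriv_eq
    have hlog : ∀ x ∈ Metric.ball (1 : ℝ) r,
        HasDerivAt (fun x => Real.log (p x - c)) (deriv p x / (p x - c)) x := fun x hx =>
      (((contDiff_infty_iff_deriv.1 hp).1 x).hasDerivAt.sub_const c).log (hball x hx).1.ne'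
    have hsub : ∀ x ∈ Metric.ball (1 : ℝ) (r / 3), x ∈ Metric.ball (1 : ℝ) r := fun x hx =>
      Metric.ball_subset_ball (by linarith) hx
    have heq : Set.EqOn g (fun x => Real.log (p x - c)) (Metric.ball (1 : ℝ) (r / 3)) := by
      refine Metric.isOpen_ball.eqOn_of_deriv_eq (x := 1) (convex_ball _ _).isPreconnected
        (fun x _ => (hg' x).differentiableAt.differentiableWithinAt)
        (fun x hx => (hlog x (hsub x hx)).differentiableAt.differentiableWithinAt)
        (fun x hx => ?_) (Metric.mem_ball_self (by linarith)) (by simp [g])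
      obtain ⟨h1, h2⟩ := hball x (hsub x hx)
      rw [(hg' x).deriv, (hlog x (hsub x hx)).deriv]
      simp only [k]
      rw [χ.one_of_mem_closedBall (Metric.ball_subset_closedBall hx), one_mul,
        Real.exp_log (div_pos h2 h1)]
    filter_upwards [Metric.ball_mem_nhds (1 : ℝ) (show 0 < r / 3 by linarith)] with x hx
    rw [heq hx]
    simp only
    rw [Real.exp_log (hball x (hsub x hx)).1]; ring
  · have hgsurj : Function.Surjective g := by
      have hm : Monotone fun x => g x - Real.exp (-B) * x := by
        have hd : ∀ x, HasDerivAt (fun x => g x - Real.exp (-B) * x)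
            (Real.exp (k x) - Real.exp (-B) * 1) x := fun x =>
          (hg' x).sub ((hasDerivAt_id x).const_mul _)
        refine monotone_of_deriv_nonneg (fun x => (hd x).differentiableAt) fun x => ?_
        rw [(hd x).deriv]
        have : Real.exp (-B) ≤ Real.exp (k x) := Real.exp_le_exp.2 (abs_le.1 (hB x)).1
        linarith
      have he := Real.exp_pos (-B)
      refine hg.continuous.surjective ?_ ?_
      · refine Filter.tendsto_atTop_mono' (f₁ := fun x => g 0 + Real.exp (-B) * x) _ ?_ ?_
        · filter_upwards [Filter.eventually_ge_atTop 0] with x hx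
          have := hm hx
          simp only at this
          linarith
        · exact Filter.tendsto_atTop_add_const_left _ _ (Filter.tendsto_id.const_mul_atTop he)
      · refine Filter.tendsto_atBot_mono' (f₁ := fun x => g 0 + Real.exp (-B) * x) _ ?_ ?_
        · filter_upwards [Filter.eventually_le_atBot 0] with x hx
          have := hm hx
          simp only at this
          linarith
        · exact Filter.tendsto_atBot_add_const_left _ _ (Filter.tendsto_id.const_mul_atBot he)
    ext y
    simp only [Set.mem_range, Set.mem_Ioi]
    constructor
    · rintro ⟨x, rfl⟩
      linarith [Real.exp_pos (g x)]
    · intro hy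
      obtain ⟨x, hx⟩ := hgsurj (Real.log (y - c))
      exact ⟨x, by rw [hx, Real.exp_log (by linarith)]; ring⟩
end

section
/- Let F : ℤ → ℕ → ℝ be a double sequence such that: F(a)(0) < F(b)(0) whenever a < b in ℤ; F(a)(1) > 0 for every a ∈ ℤ; and for all but finitely many a ∈ ℤ one has F(a)(0) = a, F(a)(1) = 1, and F(a)(n) = 0 for every n ≥ 2. Then there exists a surjective C^∞ function g : ℝ → ℝ with g'(x) > 0 for all x ∈ ℝ such that g^(n)(a) = F(a)(n) for every a ∈ ℤ and every n ∈ ℕ, and in addition the closure of the set {x ∈ ℝ : g(x) ≠ x} is compact (i.e., g is a compactly supported C^∞ diffeomorphism of ℝ). -/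
theorem borel_jet (c : ℕ → ℝ) : ∃ f : ℝ → ℝ, ContDiff ℝ (⊤ : ℕ∞) f ∧
    ∀ n, iteratedDeriv n f 0 = c n := by
  let χ : ContDiffBump (0 : ℝ) := ⟨1, 2, by norm_num, by norm_num⟩
  let φ : ℕ → ℝ → ℝ := fun n x => (c n / n.factorial) * x ^ n * χ x
  have hφ : ∀ n, ContDiff ℝ (⊤ : ℕ∞) (φ n) := fun n => by
    have := χ.contDiff (n := ⊤)
    fun_prop
  have hcs : ∀ n, HasCompactSupport (φ n) := fun n => χ.hasCompactSupport.mul_left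
  have hb : ∀ n k, ∃ M : ℝ, ∀ x, ‖iteratedFDeriv ℝ k (φ n) x‖ ≤ M := fun n k =>
    ((hcs n).iteratedFDeriv k).exists_bound_of_continuous
      ((hφ n).continuous_iteratedFDeriv (by exact_mod_cast le_top))
  choose M hM using hb
  have hM0 : ∀ n k, 0 ≤ M n k := fun n k => (norm_nonneg _).trans (hM n k 0)
  let L : ℕ → ℝ := fun n => 2 ^ n * (1 + ∑ j ∈ Finset.range n, M n j)
  have hS : ∀ n, 0 ≤ ∑ j ∈ Finset.range n, M n j := fun n => Finset.sum_nonneg fun j _ => hM0 n j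
  have hL : ∀ n, 1 ≤ L n := fun n =>
    one_le_mul_of_one_le_of_one_le (one_le_pow₀ (by norm_num)) (by linarith [hS n])
  have hL0 : ∀ n, 0 < L n := fun n => by linarith [hL n]
  let u : ℕ → ℝ → ℝ := fun n x => ((L n)⁻¹) ^ n * φ n (L n * x)
  have hu : ∀ n, ContDiff ℝ (⊤ : ℕ∞) (u n) := fun n => by
    have := hφ n
    fun_prop
  let v : ℕ → ℕ → ℝ := fun k n => ((L n)⁻¹) ^ n * ((L n) ^ k * M n k)
  have huv : ∀ k n x, ‖iteratedFDeriv ℝ k (u n) x‖ ≤ v k n := by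
    intro k n x
    rw [norm_iteratedFDeriv_eq_norm_iteratedDeriv]
    have h1 : iteratedDeriv k (u n) x = ((L n)⁻¹) ^ n * ((L n) ^ k * iteratedDeriv k (φ n) (L n * x)) := by
      simp only [u]
      rw [iteratedDeriv_const_mul_field, iteratedDeriv_comp_const_mul ((hφ n).of_le (by exact_mod_cast le_top))]
    rw [h1, norm_mul, norm_mul, norm_pow, norm_pow, norm_inv, Real.norm_of_nonneg (hL0 n).le]
    have := hM n k (L n * x)
    rw [norm_iteratedFDeriv_eq_norm_iteratedDeriv] at this
    have := hL0 n
    simp only [v]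
    gcongr
  have hv : ∀ k, Summable (v k) := by
    intro k
    refine Summable.of_norm_bounded_eventually_nat (g := fun n => (1/2 : ℝ) ^ n) summable_geometric_two ?_
    filter_upwards [Filter.eventually_gt_atTop k] with n hn
    have h0 := hL0 n
    have hvn : 0 ≤ v k n := by have := hM0 n k; simp only [v]; positivity
    rw [Real.norm_of_nonneg hvn]
    have h1 : ((L n)⁻¹) ^ n * (L n) ^ k ≤ (L n)⁻¹ := by
      obtain ⟨m, rfl⟩ := Nat.exists_eq_add_of_lt hn
      have : ((L (k+m+1))⁻¹) ^ (k+m+1) * (L (k+m+1)) ^ k = (L (k+m+1))⁻¹ * ((L (k+m+1))⁻¹)^m := by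
        generalize L (k+m+1) = l at h0
        have h5 : (l⁻¹) ^ k * l ^ k = 1 := by rw [← mul_pow, inv_mul_cancel₀ h0.ne', one_pow]
        calc (l⁻¹) ^ (k+m+1) * l ^ k = ((l⁻¹) ^ k * l ^ k) * (l⁻¹ * (l⁻¹)^m) := by ring
          _ = _ := by rw [h5, one_mul]
      rw [this]
      exact mul_le_of_le_one_right (by positivity) (pow_le_one₀ (by positivity) (inv_le_one_of_one_le₀ (hL _)))
    have h2 : M n k ≤ ∑ j ∈ Finset.range n, M n j :=
      Finset.single_le_sum (f := M n) (fun j _ => hM0 n j) (Finset.mem_range.2 hn)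
    calc v k n = ((L n)⁻¹) ^ n * (L n) ^ k * M n k := by simp only [v]; ring
      _ ≤ (L n)⁻¹ * (1 + ∑ j ∈ Finset.range n, M n j) := by
        apply mul_le_mul h1 (by linarith) (hM0 n k) (by positivity)
      _ = (1/2) ^ n := by
        have := hS n
        simp only [L]
        field_simp
        rw [← mul_pow]; norm_num
  refine ⟨fun x => ∑' n, u n x, contDiff_tsum hu (fun k _ => hv k) (fun k n x _ => huv k n x), ?_⟩
  intro n
  rw [iteratedDeriv_eq_iteratedFDeriv, iteratedFDeriv_tsum_apply (N := ⊤) hu (fun k _ => hv k) (fun k n x _ => huv k n x) (by exact_mod_cast le_top)]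
  have hsum : Summable fun m => iteratedFDeriv ℝ n (u m) 0 :=
    Summable.of_norm_bounded (hv n) (fun m => huv n m 0)
  have key : ∀ m, iteratedDeriv n (u m) 0 = if m = n then c n else 0 := by
    intro m
    have h1 : u m =ᶠ[nhds 0] fun x => (c m / m.factorial) * x ^ m := by
      have h0 := hL0 m
      have : ∀ᶠ x in nhds (0:ℝ), |L m * x| < 1 := by
        have : Continuous fun x : ℝ => |L m * x| := by fun_prop
        exact this.continuousAt.eventually_lt continuousAt_const (by simp)
      filter_upwards [this] with x hx
      have h2 : χ (L m * x) = 1 := χ.one_of_mem_closedBall (by simpa [χ] using hx.le)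
      simp only [u, φ, h2]
      have h5 : ((L m)⁻¹) ^ m * (L m) ^ m = 1 := by rw [← mul_pow, inv_mul_cancel₀ h0.ne', one_pow]
      calc _ = (((L m)⁻¹) ^ m * (L m) ^ m) * (c m / m.factorial * x ^ m) := by ring
        _ = _ := by rw [h5, one_mul]
    rw [h1.iteratedDeriv_eq, iteratedDeriv_const_mul_field, iteratedDeriv_fun_pow_zero]
    split_ifs with h3 h4 h4
    · subst h3; field_simp
    · omega
    · omega
    · simp
  have := ContinuousMultilinearMap.tsum_eval hsum (fun _ => (1:ℝ))
  rw [this]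
  simp only [← iteratedDeriv_eq_iteratedFDeriv, key]
  simp

theorem cutoff (δ : ℝ) (hδ : 0 < δ) : ∃ p : ℝ → ℝ, ContDiff ℝ (⊤ : ℕ∞) p ∧ (∀ y, 0 ≤ p y) ∧
    (∀ y, p y ≤ 1) ∧ (∀ y ≤ δ / 2, p y = 0) ∧ (∀ y, δ ≤ y → p y = 1) := by
  refine ⟨fun y => Real.smoothTransition (2 * y / δ - 1), ?_, fun y => Real.smoothTransition.nonneg _,
    fun y => Real.smoothTransition.le_one _, fun y hy => ?_, fun y hy => ?_⟩
  · exact Real.smoothTransition.contDiff.comp (by fun_prop)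
  · apply Real.smoothTransition.zero_of_nonpos
    have : 2 * y / δ ≤ 1 := by rw [div_le_one hδ]; linarith
    linarith
  · apply Real.smoothTransition.one_of_one_le
    have : 2 ≤ 2 * y / δ := by rw [le_div_iff₀ hδ]; linarith
    linarith

theorem glue (f : ℤ → ℝ → ℝ) (hfs : ∀ a, ContDiff ℝ (⊤ : ℕ∞) (f a)) (S : Finset ℤ)
    (hS : ∀ a, a ∉ S → ∀ x, f a x = 1) (d m : ℤ → ℝ)
    (hd1 : ∀ a, a ∉ S → a + 1 ∉ S → d a = 1)
    (δ : ℝ) (hδ : 0 < δ) (hδ4 : δ < 1 / 4)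
    (hf : ∀ (a : ℤ) (x : ℝ), |x - (a : ℝ)| ≤ δ → 0 < f a x ∧ f a x ≤ m a)
    (hd : ∀ a, δ * m a + δ * m (a + 1) < d a) :
    ∃ h : ℝ → ℝ, ContDiff ℝ (⊤ : ℕ∞) h ∧ (∀ x, 0 < h x) ∧
      (∀ a : ℤ, h =ᶠ[nhds (a : ℝ)] f a) ∧
      (∀ a : ℤ, ∫ x in (a : ℝ)..(a + 1), h x = d a) ∧
      (∀ a : ℤ, a ∉ S → a + 1 ∉ S → ∀ x ∈ Set.Icc (a : ℝ) (a + 1), h x = 1) := by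
  classical
  obtain ⟨p, hps, hp0, hp1, hpl, hpr⟩ := cutoff δ hδ
  have hpc : Continuous p := hps.continuous
  have hfc : ∀ a, Continuous (f a) := fun a => (hfs a).continuous
  -- left and right pieces
  let l : ℤ → ℝ → ℝ := fun a x => (1 - p (x - a)) * f a x
  let r : ℤ → ℝ → ℝ := fun a x => (1 - p (a + 1 - x)) * f (a + 1) x
  have hlc : ∀ a, Continuous (l a) := fun a => by have := hfc a; fun_prop
  have hrc : ∀ a, Continuous (r a) := fun a => by have := hfc (a + 1); fun_prop
  let J : ℝ := ∫ y in (0 : ℝ)..1, p y * p (1 - y)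
  have hJ : 0 < J := by
    refine intervalIntegral.integral_pos (by norm_num) (by fun_prop)
      (fun y _ => mul_nonneg (hp0 _) (hp0 _)) ⟨1 / 2, by norm_num, ?_⟩
    rw [hpr (1 / 2) (by linarith), hpr (1 - 1 / 2) (by linarith)]; norm_num
  have hJa : ∀ a : ℤ, ∫ x in (a : ℝ)..(a + 1), p (x - a) * p (a + 1 - x) = J := by
    intro a
    have := intervalIntegral.integral_comp_sub_right (a := (a : ℝ)) (b := a + 1)
      (fun y => p y * p (1 - y)) (a : ℝ)
    simp only [sub_self, add_sub_cancel_left] at this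
    refine Eq.trans ?_ this
    congr 1; ext x; congr 2; ring
  let s : ℤ → ℝ := fun a =>
    (d a - ((∫ x in (a : ℝ)..(a + 1), l a x) + ∫ x in (a : ℝ)..(a + 1), r a x)) / J
  have hl : ∀ a : ℤ, ∫ x in (a : ℝ)..(a + 1), l a x ≤ δ * m a := by
    intro a
    rw [← intervalIntegral.integral_add_adjacent_intervals (b := (a : ℝ) + δ)
      ((hlc a).intervalIntegrable _ _) ((hlc a).intervalIntegrable _ _)]
    have h1 : ∫ x in (a : ℝ) + δ..(a + 1), l a x = 0 := by
      rw [intervalIntegral.integral_congr (g := fun _ => 0)]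
      · simp
      · intro x hx
        rw [Set.uIcc_of_le (by linarith)] at hx
        simp only [l]
        rw [hpr _ (by linarith [hx.1])]; ring
    have h2 : ∫ x in (a : ℝ)..a + δ, l a x ≤ ∫ x in (a : ℝ)..a + δ, m a := by
      refine intervalIntegral.integral_mono_on (by linarith) ((hlc a).intervalIntegrable _ _)
        (by simp) ?_
      intro x hx
      have h3 := hf a x (by rw [abs_le]; constructor <;> linarith [hx.1, hx.2])
      have := hp0 (x - a)
      simp only [l]
      nlinarith
    simp at h2
    linarith
  have hr : ∀ a : ℤ, ∫ x in (a : ℝ)..(a + 1), r a x ≤ δ * m (a + 1) := by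
    intro a
    rw [← intervalIntegral.integral_add_adjacent_intervals (b := (a : ℝ) + 1 - δ)
      ((hrc a).intervalIntegrable _ _) ((hrc a).intervalIntegrable _ _)]
    have h1 : ∫ x in (a : ℝ)..a + 1 - δ, r a x = 0 := by
      rw [intervalIntegral.integral_congr (g := fun _ => 0)]
      · simp
      · intro x hx
        rw [Set.uIcc_of_le (by linarith)] at hx
        simp only [r]
        rw [hpr _ (by linarith [hx.2])]; ring
    have h2 : ∫ x in (a : ℝ) + 1 - δ..a + 1, r a x ≤ ∫ x in (a : ℝ) + 1 - δ..a + 1, m (a + 1) := by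
      refine intervalIntegral.integral_mono_on (by linarith) ((hrc a).intervalIntegrable _ _)
        (by simp) ?_
      intro x hx
      have h3 := hf (a + 1) x (by push_cast; rw [abs_le]; constructor <;> linarith [hx.1, hx.2])
      have := hp0 (a + 1 - x)
      simp only [r]
      nlinarith
    simp at h2
    linarith
  have hs : ∀ a, 0 < s a := fun a => div_pos (by linarith [hl a, hr a, hd a]) hJ
  -- partition identity
  have hpart : ∀ y : ℝ, (1 - p y) + (1 - p (1 - y)) + p y * p (1 - y) = 1 := by
    intro y
    have : (1 - p y) * (1 - p (1 - y)) = 0 := by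
      rcases le_total δ y with h | h
      · rw [hpr y h]; ring
      · rw [hpr (1 - y) (by linarith)]; ring
    linarith
  have hqi : ∀ (a : ℤ) (c : ℝ), IntervalIntegrable (fun x => c * (p (x - a) * p (a + 1 - x)))
      MeasureTheory.volume (a : ℝ) (a + 1) := fun a c =>
    (by fun_prop : Continuous (fun x => c * (p (x - a) * p (a + 1 - x)))).intervalIntegrable _ _
  have hlri : ∀ a : ℤ, IntervalIntegrable (fun x => l a x + r a x)
      MeasureTheory.volume (a : ℝ) (a + 1) := fun a =>
    ((hlc a).add (hrc a)).intervalIntegrable _ _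
  have hs1 : ∀ a, a ∉ S → a + 1 ∉ S → s a = 1 := by
    intro a h1 h2
    simp only [s]
    rw [div_eq_one_iff_eq hJ.ne', hd1 a h1 h2, ← intervalIntegral.integral_add
      ((hlc a).intervalIntegrable _ _) ((hrc a).intervalIntegrable _ _), sub_eq_iff_eq_add,
      ← hJa a, ← intervalIntegral.integral_add
      (by simpa using hqi a 1) (hlri a)]
    rw [intervalIntegral.integral_congr (g := fun _ => 1)]
    · simp
    · intro x _
      have := hpart (x - a)
      simp only [l, r, hS a h1, hS (a + 1) h2]
      rw [show (1 : ℝ) - (x - a) = a + 1 - x by ring] at this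
      linarith
  let T : Finset ℤ := S ∪ S.image (· - 1)
  have hT : ∀ a, a ∉ T → a ∉ S ∧ a + 1 ∉ S := by
    intro a ha
    simp only [T, Finset.mem_union, Finset.mem_image, not_or, not_exists, not_and] at ha
    exact ⟨ha.1, fun h => ha.2 (a + 1) h (by ring)⟩
  let A : ℝ → ℝ := fun x => ∑ a ∈ S, (1 - p (x - a)) * (1 - p (a - x)) * (f a x - 1)
  let B : ℝ → ℝ := fun x => ∑ a ∈ T, (s a - 1) * (p (x - a) * p (a + 1 - x))
  have hAs : ContDiff ℝ (⊤ : ℕ∞) A := by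
    refine ContDiff.sum fun a _ => ?_
    have := hfs a
    fun_prop
  have hBs : ContDiff ℝ (⊤ : ℕ∞) B := by
    refine ContDiff.sum fun a _ => ?_
    fun_prop
  have hfar : ∀ (a b : ℤ) (x : ℝ), |x - a| < 1 - δ → b ≠ a →
      (1 - p (x - b)) * (1 - p (b - x)) = 0 := by
    intro a b x hx hb
    rw [abs_lt] at hx
    rcases lt_or_gt_of_ne hb with h | h
    · have : (b : ℝ) + 1 ≤ a := by exact_mod_cast h
      rw [hpr (x - b) (by linarith)]; ring
    · have : (a : ℝ) + 1 ≤ b := by exact_mod_cast h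
      rw [hpr (b - x) (by linarith)]; ring
  have hA : ∀ (a : ℤ) (x : ℝ), |x - a| < 1 - δ →
      A x = (1 - p (x - a)) * (1 - p (a - x)) * (f a x - 1) := by
    intro a x hx
    refine Finset.sum_eq_single a (fun b _ hb => ?_) (fun ha => ?_)
    · rw [hfar a b x hx hb, zero_mul]
    · rw [hS a ha]; ring
  have hB : ∀ (a : ℤ) (x : ℝ), a - δ / 2 ≤ x → x ≤ a + 1 + δ / 2 →
      B x = (s a - 1) * (p (x - a) * p (a + 1 - x)) := by
    intro a x h1 h2
    refine Finset.sum_eq_single a (fun b _ hb => ?_) (fun ha => ?_)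
    · rcases lt_or_gt_of_ne hb with h | h
      · have : (b : ℝ) + 1 ≤ a := by exact_mod_cast h
        rw [hpl (b + 1 - x) (by linarith)]; ring
      · have : (a : ℝ) + 1 ≤ b := by exact_mod_cast h
        rw [hpl (x - b) (by linarith)]; ring
    · rw [hs1 a (hT a ha).1 (hT a ha).2]; ring
  have hform : ∀ (a : ℤ) (x : ℝ), x ∈ Set.Icc (a : ℝ) (a + 1) →
      1 + A x + B x = l a x + r a x + s a * (p (x - a) * p (a + 1 - x)) := by
    intro a x hx
    have hpx := hpart (x - a)
    rw [show (1 : ℝ) - (x - a) = a + 1 - x by ring] at hpx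
    rw [hB a x (by linarith [hx.1]) (by linarith [hx.2])]
    simp only [l, r]
    rcases le_total x (a + 1 / 2) with h | h
    · rw [hA a x (by rw [abs_lt]; constructor <;> linarith [hx.1])]
      rw [hpl (a - x) (by linarith [hx.1])]
      rw [hpr (a + 1 - x) (by linarith)] at *
      linear_combination hpx
    · rw [hA (a + 1) x (by push_cast; rw [abs_lt]; constructor <;> linarith [hx.2])]
      push_cast
      rw [hpl (x - (a + 1)) (by linarith [hx.2])]
      rw [hpr (x - a) (by linarith)] at *
      linear_combination hpx
  refine ⟨fun x => 1 + A x + B x, by fun_prop, ?_, ?_, ?_, ?_⟩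
  · intro x
    have hx : x ∈ Set.Icc (⌊x⌋ : ℝ) (⌊x⌋ + 1) := ⟨Int.floor_le x, (Int.lt_floor_add_one x).le⟩
    show 0 < 1 + A x + B x
    rw [hform ⌊x⌋ x hx]
    generalize ⌊x⌋ = a at hx
    have hl0 : 0 ≤ l a x := by
      rcases le_total δ (x - a) with h | h
      · simp only [l]; rw [hpr _ h]; simp
      · exact mul_nonneg (by linarith [hp1 (x - a)])
          (hf a x (by rw [abs_le]; constructor <;> linarith [hx.1])).1.le
    have hr0 : 0 ≤ r a x := by
      rcases le_total δ (a + 1 - x) with h | h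
      · simp only [r]; rw [hpr _ h]; simp
      · exact mul_nonneg (by linarith [hp1 (a + 1 - x)])
          (hf (a + 1) x (by push_cast; rw [abs_le]; constructor <;> linarith [hx.2])).1.le
    have hq0 : 0 ≤ s a * (p (x - a) * p (a + 1 - x)) :=
      mul_nonneg (hs a).le (mul_nonneg (hp0 _) (hp0 _))
    by_contra hcon
    have e1 : l a x = 0 := by linarith
    have e2 : r a x = 0 := by linarith
    have e3 : s a * (p (x - a) * p (a + 1 - x)) = 0 := by linarith
    have hpx := hpart (x - a)
    rw [show (1 : ℝ) - (x - a) = a + 1 - x by ring] at hpx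
    have e4 : p (x - a) * p (a + 1 - x) = 0 := (mul_eq_zero.1 e3).resolve_left (hs a).ne'
    have e5 : 1 - p (x - a) = 0 := by
      rcases le_total δ (x - a) with h | h
      · rw [hpr _ h]; simp
      · exact (mul_eq_zero.1 e1).resolve_right
          (hf a x (by rw [abs_le]; constructor <;> linarith [hx.1])).1.ne'
    have e6 : 1 - p (a + 1 - x) = 0 := by
      rcases le_total δ (a + 1 - x) with h | h
      · rw [hpr _ h]; simp
      · exact (mul_eq_zero.1 e2).resolve_right
          (hf (a + 1) x (by push_cast; rw [abs_le]; constructor <;> linarith [hx.2])).1.ne'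
    linarith
  · intro a
    filter_upwards [Metric.ball_mem_nhds (a : ℝ) (half_pos hδ)] with x hx
    rw [Metric.mem_ball, Real.dist_eq] at hx
    rw [hA a x (by linarith)]
    rw [abs_lt] at hx
    rw [hB a x (by linarith) (by linarith), hpl (x - a) (by linarith), hpl (a - x) (by linarith)]
    ring
  · intro a
    rw [intervalIntegral.integral_congr
      (g := fun x => l a x + r a x + s a * (p (x - a) * p (a + 1 - x)))]
    · rw [intervalIntegral.integral_add (hlri a) (hqi a (s a)),
        intervalIntegral.integral_add ((hlc a).intervalIntegrable _ _)
        ((hrc a).intervalIntegrable _ _), intervalIntegral.integral_const_mul, hJa a]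
      simp only [s]
      rw [div_mul_cancel₀ _ hJ.ne']; ring
    · intro x hx
      rw [Set.uIcc_of_le (by linarith)] at hx
      exact hform a x hx
  · intro a h1 h2 x hx
    show 1 + A x + B x = 1
    rw [hform a x hx, hs1 a h1 h2]
    have hpx := hpart (x - a)
    rw [show (1 : ℝ) - (x - a) = a + 1 - x by ring] at hpx
    simp only [l, r, hS a h1, hS (a + 1) h2]
    linarith


/-- interpolation of an admissible double sequence of jets on ℤ,
trivial outside a finite set, by a compactly supported orientation-preserving
C^∞ diffeomorphism of ℝ. -/
theorem stmt_16 (F : ℤ → ℕ → ℝ)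
    (hmono : ∀ a b : ℤ, a < b → F a 0 < F b 0)
    (hpos : ∀ a : ℤ, 0 < F a 1)
    (hfin : Set.Finite {a : ℤ |
      ¬ (F a 0 = a ∧ F a 1 = 1 ∧ ∀ n : ℕ, 2 ≤ n → F a n = 0)}) :
    ∃ g : ℝ → ℝ, ContDiff ℝ (⊤ : ℕ∞) g ∧ Function.Surjective g ∧
      (∀ x : ℝ, 0 < deriv g x) ∧
      (∀ a : ℤ, ∀ n : ℕ, iteratedDeriv n g a = F a n) ∧
      IsCompact (closure {x : ℝ | g x ≠ x}) := by
  classical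
  let S : Finset ℤ := hfin.toFinset
  have hS : ∀ a, a ∉ S → F a 0 = a ∧ F a 1 = 1 ∧ ∀ n : ℕ, 2 ≤ n → F a n = 0 := by
    intro a ha
    simpa only [S, Set.Finite.mem_toFinset, Set.mem_ofPred_eq, not_not] using ha
  have hex : ∀ a : ℤ, ∃ f : ℝ → ℝ, ContDiff ℝ (⊤ : ℕ∞) f ∧
      (∀ n, iteratedDeriv n f a = F a (n + 1)) ∧ (a ∉ S → ∀ x, f x = 1) := by
    intro a
    by_cases ha : a ∈ S
    · obtain ⟨f, h1, h2⟩ := borel_jet (fun n => F a (n + 1))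
      refine ⟨fun x => f (x - a), by fun_prop, fun n => ?_, fun h => absurd ha h⟩
      rw [iteratedDeriv_comp_sub_const]
      simp [h2]
    · obtain ⟨-, h1, h2⟩ := hS a ha
      refine ⟨fun _ => 1, contDiff_const, fun n => ?_, fun _ _ => rfl⟩
      rw [iteratedDeriv_const]
      rcases n with _ | n
      · simp [h1]
      · simp [h2 (n + 1 + 1) (by omega)]
  choose f hfs hfj hf1 using hex
  have hfa : ∀ a : ℤ, f a a = F a 1 := fun a => by simpa using hfj a 0
  let T : Finset ℤ := S ∪ S.image (· - 1)
  have hT : ∀ a, a ∉ T → a ∉ S ∧ a + 1 ∉ S := by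
    intro a ha
    simp only [T, Finset.mem_union, Finset.mem_image, not_or, not_exists, not_and] at ha
    exact ⟨ha.1, fun h => ha.2 (a + 1) h (by ring)⟩
  let d : ℤ → ℝ := fun a => F (a + 1) 0 - F a 0
  let m : ℤ → ℝ := fun a => F a 1 + 1
  have hd0 : ∀ a, 0 < d a := fun a => sub_pos.2 (hmono a (a + 1) (by omega))
  have hd1 : ∀ a, a ∉ S → a + 1 ∉ S → d a = 1 := by
    intro a h1 h2
    simp only [d]
    rw [(hS a h1).1, (hS _ h2).1]; push_cast; ring
  have ev1 : ∀ a ∈ S, ∀ᶠ δ : ℝ in nhdsWithin (0 : ℝ) (Set.Ioi 0),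
      ∀ x : ℝ, |x - (a : ℝ)| ≤ δ → 0 < f a x ∧ f a x ≤ m a := by
    intro a _
    have hc := (hfs a).continuous.continuousAt (x := (a : ℝ))
    have h1 : ∀ᶠ x in nhds (a : ℝ), 0 < f a x ∧ f a x < m a :=
      (hc.eventually_const_lt (by rw [hfa]; exact hpos a)).and
        (hc.eventually_lt_const (by rw [hfa]; simp [m]))
    obtain ⟨ε, hε, h2⟩ := Metric.eventually_nhds_iff.1 h1
    filter_upwards [Ioo_mem_nhdsGT hε] with δ hδ x hx
    have := h2 (y := x) (by rw [Real.dist_eq]; exact lt_of_le_of_lt hx hδ.2)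
    exact ⟨this.1, this.2.le⟩
  have ev2 : ∀ a ∈ T, ∀ᶠ δ : ℝ in nhdsWithin (0 : ℝ) (Set.Ioi 0), δ * m a + δ * m (a + 1) < d a := by
    intro a _
    have hc : Continuous fun δ : ℝ => δ * m a + δ * m (a + 1) := by fun_prop
    exact (hc.continuousAt.eventually_lt_const (by simpa using hd0 a)).filter_mono
      nhdsWithin_le_nhds
  obtain ⟨δ, h1, h2, h3⟩ := (((Filter.eventually_all_finset S).2 ev1).and
    (((Filter.eventually_all_finset T).2 ev2).and
      (Ioo_mem_nhdsGT (show (0 : ℝ) < 1 / 4 by norm_num)))).exists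
  have hf : ∀ a x, |x - ((a : ℤ) : ℝ)| ≤ δ → 0 < f a x ∧ f a x ≤ m a := by
    intro a x hx
    by_cases ha : a ∈ S
    · exact h1 a ha x hx
    · rw [hf1 a ha]; simp [m, (hpos a).le]
  have hd : ∀ a, δ * m a + δ * m (a + 1) < d a := by
    intro a
    by_cases ha : a ∈ T
    · exact h2 a ha
    · obtain ⟨h4, h5⟩ := hT a ha
      rw [hd1 a h4 h5]
      simp only [m]
      rw [(hS a h4).2.1, (hS _ h5).2.1]
      linarith [h3.2]
  obtain ⟨h, hs, hp, hj, hint, hone⟩ := glue f hfs S hf1 d m hd1 δ h3.1 h3.2 hf hd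
  have hc := hs.continuous
  let g : ℝ → ℝ := fun x => F 0 0 + ∫ t in (0 : ℝ)..x, h t
  have hg' : ∀ x, HasDerivAt g (h x) x := fun x =>
    (intervalIntegral.integral_hasDerivAt_right (hc.intervalIntegrable _ _)
      (hc.stronglyMeasurableAtFilter _ _) hc.continuousAt).const_add _
  have hdg : deriv g = h := funext fun x => (hg' x).deriv
  have hgc : Continuous g := continuous_iff_continuousAt.2 fun x => (hg' x).continuousAt
  have hadd : ∀ x y, g y = g x + ∫ t in x..y, h t := by
    intro x y
    simp only [g]
    rw [← intervalIntegral.integral_add_adjacent_intervals (hc.intervalIntegrable 0 x)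
      (hc.intervalIntegrable x y)]; ring
  have hstep : ∀ a : ℤ, g ((a : ℝ) + 1) = g a + (F (a + 1) 0 - F a 0) := by
    intro a
    rw [hadd a (a + 1), hint a]
  have hga : ∀ a : ℤ, g a = F a 0 := by
    intro a
    induction a using Int.induction_on with
    | zero => simp [g]
    | succ i ih =>
      have := hstep i
      push_cast at this ih ⊢
      linarith
    | pred i ih =>
      have := hstep (-i - 1)
      push_cast at this ih ⊢
      rw [sub_add_cancel, sub_add_cancel] at this
      linarith
  have hid : ∀ a : ℤ, a ∉ T → ∀ x ∈ Set.Icc (a : ℝ) (a + 1), g x = x := by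
    intro a ha x hx
    obtain ⟨h4, h5⟩ := hT a ha
    rw [hadd a x, hga, (hS a h4).1, intervalIntegral.integral_congr (g := fun _ => 1)]
    · simp
    · intro t ht
      rw [Set.uIcc_of_le hx.1] at ht
      exact hone a h4 h5 t ⟨ht.1, ht.2.trans hx.2⟩
  have hK : IsCompact (⋃ a ∈ T, Set.Icc (a : ℝ) (a + 1)) :=
    T.isCompact_biUnion fun a _ => isCompact_Icc
  have hsub : {x : ℝ | g x ≠ x} ⊆ ⋃ a ∈ T, Set.Icc (a : ℝ) (a + 1) := by
    intro x hx
    have hx1 : x ∈ Set.Icc (⌊x⌋ : ℝ) (⌊x⌋ + 1) := ⟨Int.floor_le x, (Int.lt_floor_add_one x).le⟩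
    by_contra hcon
    refine hx (hid ⌊x⌋ (fun hT' => hcon ?_) x hx1)
    exact Set.mem_biUnion (by exact hT') hx1
  obtain ⟨R, hR⟩ := hK.isBounded.subset_closedBall 0
  have hout : ∀ x, R < |x| → g x = x := by
    intro x hx
    by_contra hcon
    have := hR (hsub hcon)
    rw [mem_closedBall_zero_iff, Real.norm_eq_abs] at this
    linarith
  refine ⟨g, ?_, ?_, ?_, ?_, ?_⟩
  · rw [contDiff_infty_iff_deriv, hdg]
    exact ⟨fun x => (hg' x).differentiableAt, hs⟩
  · refine hgc.surjective ?_ ?_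
    · refine Filter.tendsto_id.congr' ?_
      filter_upwards [Filter.eventually_gt_atTop R] with x hx
      exact (hout x (lt_of_lt_of_le hx (le_abs_self x))).symm
    · refine Filter.tendsto_id.congr' ?_
      filter_upwards [Filter.eventually_lt_atBot (-R)] with x hx
      exact (hout x (lt_of_lt_of_le (by linarith) (neg_le_abs x))).symm
  · intro x; rw [hdg]; exact hp x
  · intro a n
    rcases n with _ | n
    · simpa using hga a
    · rw [iteratedDeriv_succ', hdg, (hj a).iteratedDeriv_eq, hfj]
  · exact hK.closure_of_subset hsub
end
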